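/- Let G and H be locally finite, connected, infinite simple graphs of bounded degree such that there exists a strong covering map π : V(G) → V(H) with uniformly non-trivial fibres. If p_c(G) < 1, then p_c(G) < p_c(H). -/

import Mathlib

open MeasureTheory
open scoped Classical ENNReal

/-- The Bernoulli measure on `Bool` with parameter `p` (`true` = open, with prob. `p`). -/
noncomputable def bernoulliMeasure (p : ℝ) : Measure Bool :=
  ENNReal.ofReal p • Measure.dirac true + ENNReal.ofReal (1 - p) • Measure.dirac false

/-- The Bernoulli(`p`) product measure on configurations `ι → Bool`, realized as the
Carathéodory-extension outer measure of the product premeasure; on measurable sets it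
is the usual i.i.d. Bernoulli product probability measure. -/
noncomputable def bernoulliProduct (ι : Type*) (p : ℝ) : OuterMeasure (ι → Bool) :=
  OuterMeasure.ofFunction
    (fun A : Set (ι → Bool) =>
      if A = ∅ then 0 else ∏' i : ι, bernoulliMeasure p (Function.eval i '' A))
    (by simp)

/-- The subgraph of open edges of the configuration `ω` (an edge `e` is open iff `ω e = true`). -/
def openSubgraph {V : Type*} (G : SimpleGraph V) (ω : G.edgeSet → Bool) : SimpleGraph V :=
  G.deleteEdges {e : Sym2 V | ∃ h : e ∈ G.edgeSet, ω ⟨e, h⟩ = false}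

/-- The event that the open subgraph has an infinite connected component. -/
def HasInfiniteCluster {V : Type*} (G : SimpleGraph V) (ω : G.edgeSet → Bool) : Prop :=
  ∃ v : V, {w : V | (openSubgraph G ω).Reachable v w}.Infinite

/-- The critical percolation threshold
`p_c(G) = sup {p ∈ [0,1] | ℙ_p(∃ an infinite connected component) = 0}`. -/
noncomputable def pc {V : Type*} (G : SimpleGraph V) : ℝ :=
  sSup {p : ℝ | p ∈ Set.Icc (0 : ℝ) 1 ∧
    bernoulliProduct G.edgeSet p {ω | HasInfiniteCluster G ω} = 0}

/-- `π` is a strong covering map from `G` to `H`: it is 1-Lipschitz for the graph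
distances and has the strong lifting property (every neighbour of `π x` has a unique
lift to a neighbour of `x`). -/
def IsStrongCoveringMap {VG VH : Type*} (G : SimpleGraph VG) (H : SimpleGraph VH)
    (π : VG → VH) : Prop :=
  (∀ x y : VG, H.dist (π x) (π y) ≤ G.dist x y) ∧
  ∀ (x : VG) (u : VH), H.Adj (π x) u → ∃! y : VG, G.Adj x y ∧ π y = u

/-- `π` has uniformly non-trivial fibres: there is `R` such that every `x` admits a
`y ≠ x` in the same fibre with `0 < d_G(x, y) ≤ R`. -/
def HasUniformlyNontrivialFibres {VG VH : Type*} (G : SimpleGraph VG) (π : VG → VH) : Prop :=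
  ∃ R : ℕ, ∀ x : VG, ∃ y : VG, π x = π y ∧ 0 < G.dist x y ∧ G.dist x y ≤ R

section BernoulliProb

variable {ι : Type*}

/-- The probability of the event `E` when each coordinate `i ∈ S` is open independently with
probability `a i` and the coordinates outside `S` are closed. -/
noncomputable def bernoulliProb (S : Finset ι) (a : ι → ℝ) (E : Set (Set ι)) : ℝ :=
  ∑ A ∈ S.powerset, (∏ i ∈ S, if i ∈ A then a i else 1 - a i) *
    if (A : Set ι) ∈ E then 1 else 0

/-- The event that the coordinate `i` is pivotal for `E`. -/
def pivotalEvent (i : ι) (E : Set (Set ι)) : Set (Set ι) :=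
  {A | insert i A ∈ E ∧ A \ {i} ∉ E}

lemma bernoulliProb_congr {S : Finset ι} {a b : ι → ℝ} (h : ∀ i ∈ S, a i = b i)
    (E : Set (Set ι)) : bernoulliProb S a E = bernoulliProb S b E := by
  unfold bernoulliProb
  refine Finset.sum_congr rfl fun A _ => ?_
  congr 1
  exact Finset.prod_congr rfl fun i hi => by rw [h i hi]

lemma bernoulliProb_empty (a : ι → ℝ) (E : Set (Set ι)) :
    bernoulliProb ∅ a E = if ∅ ∈ E then 1 else 0 := by
  unfold bernoulliProb
  rw [Finset.powerset_empty, Finset.sum_singleton, Finset.prod_empty, one_mul, Finset.coe_empty]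

lemma bernoulliProb_insert [DecidableEq ι] {i : ι} {S : Finset ι} (hi : i ∉ S) (a : ι → ℝ)
    (E : Set (Set ι)) :
    bernoulliProb (insert i S) a E =
      a i * bernoulliProb S a {A | insert i A ∈ E} + (1 - a i) * bernoulliProb S a E := by
  unfold bernoulliProb
  rw [Finset.sum_powerset_insert hi, add_comm, Finset.mul_sum, Finset.mul_sum]
  congr 1
  · refine Finset.sum_congr rfl fun A hA => ?_
    rw [Finset.prod_insert hi, if_pos (Finset.mem_insert_self i A), mul_assoc]
    congr 2
    · refine Finset.prod_congr rfl fun j hj => ?_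
      have : j ≠ i := fun h => hi (h ▸ hj)
      simp [this]
    · simp
  · refine Finset.sum_congr rfl fun A hA => ?_
    have : i ∉ A := fun h => hi (Finset.mem_powerset.1 hA h)
    rw [Finset.prod_insert hi, if_neg this, mul_assoc]

lemma bernoulliProb_nonneg {S : Finset ι} {a : ι → ℝ} (h0 : ∀ i ∈ S, 0 ≤ a i)
    (h1 : ∀ i ∈ S, a i ≤ 1) (E : Set (Set ι)) : 0 ≤ bernoulliProb S a E := by
  refine Finset.sum_nonneg fun A _ => mul_nonneg (Finset.prod_nonneg fun i hi => ?_) ?_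
  · split_ifs
    · exact h0 i hi
    · linarith [h1 i hi]
  · split_ifs <;> norm_num

lemma bernoulliProb_univ (S : Finset ι) (a : ι → ℝ) : bernoulliProb S a Set.univ = 1 := by
  induction S using Finset.induction_on with
  | empty => simp [bernoulliProb_empty]
  | insert i S hi ih =>
    rw [bernoulliProb_insert hi]
    simp [ih]

/-- Only the configurations compatible with the deterministic coordinates matter. -/
lemma bernoulliProb_mono {S : Finset ι} {a : ι → ℝ} (h0 : ∀ i ∈ S, 0 ≤ a i)
    (h1 : ∀ i ∈ S, a i ≤ 1) {E F : Set (Set ι)}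
    (h : ∀ A : Set ι, A ⊆ S → (∀ i ∈ S, a i = 0 → i ∉ A) → (∀ i ∈ S, a i = 1 → i ∈ A) →
      A ∈ E → A ∈ F) :
    bernoulliProb S a E ≤ bernoulliProb S a F := by
  refine Finset.sum_le_sum fun A hA => ?_
  have hA := Finset.mem_powerset.1 hA
  have hw : 0 ≤ ∏ i ∈ S, if i ∈ A then a i else 1 - a i := by
    refine Finset.prod_nonneg fun i hi => ?_
    split_ifs
    · exact h0 i hi
    · linarith [h1 i hi]
  by_cases hz : (∏ i ∈ S, if i ∈ A then a i else 1 - a i) = 0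
  · simp [hz]
  refine mul_le_mul_of_nonneg_left ?_ hw
  rw [Finset.prod_eq_zero_iff] at hz
  push Not at hz
  by_cases hE : (A : Set ι) ∈ E
  · rw [if_pos hE, if_pos]
    refine h A (by exact_mod_cast hA) (fun i hi hai hiA => ?_) (fun i hi hai => ?_) hE
    · exact hz i hi (by rw [if_pos (by exact_mod_cast hiA), hai])
    · by_contra hiA
      exact hz i hi (by rw [if_neg (by exact_mod_cast hiA), hai, sub_self])
  · rw [if_neg hE]
    split_ifs <;> norm_num

lemma bernoulliProb_congr_event {S : Finset ι} {a : ι → ℝ} {E F : Set (Set ι)}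
    (h : ∀ A : Set ι, A ⊆ S → (A ∈ E ↔ A ∈ F)) :
    bernoulliProb S a E = bernoulliProb S a F := by
  refine Finset.sum_congr rfl fun A hA => ?_
  rw [if_congr (h A (by exact_mod_cast Finset.mem_powerset.1 hA)) rfl rfl]

lemma bernoulliProb_le_one {S : Finset ι} {a : ι → ℝ} (h0 : ∀ i ∈ S, 0 ≤ a i)
    (h1 : ∀ i ∈ S, a i ≤ 1) (E : Set (Set ι)) : bernoulliProb S a E ≤ 1 := by
  rw [← bernoulliProb_univ S a]
  exact bernoulliProb_mono h0 h1 fun _ _ _ _ _ => trivial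

lemma bernoulliProb_union_le {S : Finset ι} {a : ι → ℝ} (h0 : ∀ i ∈ S, 0 ≤ a i)
    (h1 : ∀ i ∈ S, a i ≤ 1) (E F : Set (Set ι)) :
    bernoulliProb S a (E ∪ F) ≤ bernoulliProb S a E + bernoulliProb S a F := by
  unfold bernoulliProb
  rw [← Finset.sum_add_distrib]
  refine Finset.sum_le_sum fun A _ => ?_
  rw [← mul_add]
  refine mul_le_mul_of_nonneg_left ?_ (Finset.prod_nonneg fun i hi => ?_)
  · by_cases hE : (A : Set ι) ∈ E <;> by_cases hF : (A : Set ι) ∈ F <;> simp [hE, hF]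
  · split_ifs
    · exact h0 i hi
    · linarith [h1 i hi]

lemma bernoulliProb_biUnion_le {κ : Type*} {S : Finset ι} {a : ι → ℝ} (h0 : ∀ i ∈ S, 0 ≤ a i)
    (h1 : ∀ i ∈ S, a i ≤ 1) (J : Finset κ) (E : κ → Set (Set ι)) :
    bernoulliProb S a (⋃ j ∈ J, E j) ≤ ∑ j ∈ J, bernoulliProb S a (E j) := by
  induction J using Finset.induction_on with
  | empty => simp [bernoulliProb]
  | insert j J hj ih =>
    rw [Finset.set_biUnion_insert, Finset.sum_insert hj]
    exact (bernoulliProb_union_le h0 h1 _ _).trans (by gcongr)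

lemma isUpperSet_insert_mem {E : Set (Set ι)} (hE : IsUpperSet E) (i : ι) :
    IsUpperSet {A : Set ι | insert i A ∈ E} :=
  fun _ _ hAB hA => hE (Set.insert_subset_insert hAB) hA

lemma bernoulliProb_le_insert_mem {S : Finset ι} {a : ι → ℝ} (h0 : ∀ i ∈ S, 0 ≤ a i)
    (h1 : ∀ i ∈ S, a i ≤ 1) {E : Set (Set ι)} (hE : IsUpperSet E) (i : ι) :
    bernoulliProb S a E ≤ bernoulliProb S a {A | insert i A ∈ E} :=
  bernoulliProb_mono h0 h1 fun _ _ _ _ hA => hE (Set.subset_insert i _) hA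

/-- Increasing events become more likely when the parameters increase. -/
lemma bernoulliProb_le_of_le {S : Finset ι} {a b : ι → ℝ} (h0 : ∀ i ∈ S, 0 ≤ a i)
    (h1 : ∀ i ∈ S, b i ≤ 1) (hab : ∀ i ∈ S, a i ≤ b i) {E : Set (Set ι)} (hE : IsUpperSet E) :
    bernoulliProb S a E ≤ bernoulliProb S b E := by
  induction S using Finset.induction_on generalizing E with
  | empty => simp [bernoulliProb_empty]
  | insert i S hi ih =>
    have hS : ∀ j ∈ S, j ∈ insert i S := fun j hj => Finset.mem_insert_of_mem hj
    have hiS := Finset.mem_insert_self i S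
    rw [bernoulliProb_insert hi, bernoulliProb_insert hi]
    have e1 := ih (fun j hj => h0 j (hS j hj)) (fun j hj => h1 j (hS j hj))
      (fun j hj => hab j (hS j hj)) (isUpperSet_insert_mem hE i)
    have e2 := ih (fun j hj => h0 j (hS j hj)) (fun j hj => h1 j (hS j hj))
      (fun j hj => hab j (hS j hj)) hE
    have e3 := bernoulliProb_le_insert_mem (a := b)
      (fun j hj => (h0 j (hS j hj)).trans (hab j (hS j hj))) (fun j hj => h1 j (hS j hj)) hE i
    nlinarith [h0 i hiS, h1 i hiS, hab i hiS]

/-- Increasing events become more likely when more coordinates may be open. -/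
lemma bernoulliProb_le_of_subset {S T : Finset ι} (hST : S ⊆ T) {a : ι → ℝ} (h0 : ∀ i, 0 ≤ a i)
    (h1 : ∀ i, a i ≤ 1) {E : Set (Set ι)} (hE : IsUpperSet E) :
    bernoulliProb S a E ≤ bernoulliProb T a E := by
  induction T using Finset.induction_on generalizing S E with
  | empty => rw [Finset.subset_empty.1 hST]
  | insert i T hi ih =>
    have key : ∀ S ⊆ T, ∀ {E : Set (Set ι)}, IsUpperSet E →
        bernoulliProb S a E ≤ bernoulliProb (insert i T) a E := by
      intro S hS E hE
      rw [bernoulliProb_insert hi]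
      have e1 := ih hS hE
      have e3 := bernoulliProb_le_insert_mem (S := T) (fun j _ => h0 j) (fun j _ => h1 j) hE i
      nlinarith [h0 i, h1 i]
    by_cases hiS : i ∈ S
    · obtain ⟨S, hiS', rfl⟩ : ∃ S', i ∉ S' ∧ insert i S' = S :=
        ⟨S.erase i, Finset.notMem_erase i S, Finset.insert_erase hiS⟩
      have hS : S ⊆ T := (Finset.insert_subset_insert_iff hiS').1 hST
      rw [bernoulliProb_insert hi, bernoulliProb_insert hiS']
      have e1 := ih hS hE
      have e2 := ih hS (isUpperSet_insert_mem hE i)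
      nlinarith [h0 i, h1 i]
    · exact key S (fun j hj => (Finset.mem_insert.1 (hST hj)).resolve_left
        fun h => hiS (h ▸ hj)) hE

/-- The probability of an event that depends only on the coordinates in `D` depends only on the
parameters in `D`. -/
lemma bernoulliProb_congr_of_depends {S : Finset ι} {a b : ι → ℝ} {E : Set (Set ι)} {D : Set ι}
    (hD : ∀ A, A ∈ E ↔ A ∩ D ∈ E) (hab : ∀ i ∈ S, i ∈ D → a i = b i) :
    bernoulliProb S a E = bernoulliProb S b E := by
  induction S using Finset.induction_on generalizing E with
  | empty => simp [bernoulliProb_empty]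
  | insert i S hi ih =>
    have hab' : ∀ j ∈ S, j ∈ D → a j = b j := fun j hj => hab j (Finset.mem_insert_of_mem hj)
    rw [bernoulliProb_insert hi, bernoulliProb_insert hi]
    by_cases hiD : i ∈ D
    · rw [hab i (Finset.mem_insert_self i S) hiD, ih hD hab', ih (E := {A | insert i A ∈ E})
        (fun A => ?_) hab']
      simp only [Set.mem_ofPred_eq]
      rw [hD (insert i A), hD (insert i (A ∩ D)), Set.insert_inter_of_mem hiD,
        Set.insert_inter_of_mem hiD, Set.inter_assoc, Set.inter_self]
    · have : {A | insert i A ∈ E} = E := by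
        ext A
        rw [Set.mem_ofPred_eq, hD (insert i A), Set.insert_inter_of_notMem hiD, ← hD]
      rw [this, ih hD hab']
      ring

lemma bernoulliProb_update_of_notMem [DecidableEq ι] {i : ι} {S : Finset ι} (hi : i ∉ S)
    (a : ι → ℝ) (x : ℝ) (E : Set (Set ι)) :
    bernoulliProb S (Function.update a i x) E = bernoulliProb S a E :=
  bernoulliProb_congr (fun j hj => Function.update_of_ne (fun h => hi (by rwa [← h])) x a) E

/-- Conditioning on the coordinate `i`. -/
lemma bernoulliProb_eq_update [DecidableEq ι] {i : ι} {S : Finset ι} (hi : i ∈ S) (a : ι → ℝ)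
    (E : Set (Set ι)) :
    bernoulliProb S a E = a i * bernoulliProb S (Function.update a i 1) E +
      (1 - a i) * bernoulliProb S (Function.update a i 0) E := by
  obtain ⟨S, hiS, rfl⟩ : ∃ S', i ∉ S' ∧ insert i S' = S :=
    ⟨S.erase i, Finset.notMem_erase i S, Finset.insert_erase hi⟩
  simp only [bernoulliProb_insert hiS, bernoulliProb_update_of_notMem hiS, Function.update_self]
  ring

lemma bernoulliProb_update_le [DecidableEq ι] {i : ι} {S : Finset ι} {a : ι → ℝ}
    (h0 : ∀ j, 0 ≤ a j) (h1 : ∀ j, a j ≤ 1) {E : Set (Set ι)} (hE : IsUpperSet E)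
    {x y : ℝ} (hx : 0 ≤ x) (hxy : x ≤ y) (hy : y ≤ 1) :
    bernoulliProb S (Function.update a i x) E ≤ bernoulliProb S (Function.update a i y) E := by
  refine bernoulliProb_le_of_le (fun j _ => ?_) (fun j _ => ?_) (fun j _ => ?_) hE
  all_goals
    rcases eq_or_ne j i with rfl | hj
    · simp [*]
    · simp [hj, h0, h1]

/-- Changing the state of a coordinate has bounded cost. -/
lemma mul_bernoulliProb_modify_le {i : ι} {S : Finset ι} (hi : i ∈ S) {a : ι → ℝ}
    (h0 : ∀ i ∈ S, 0 ≤ a i) (h1 : ∀ i ∈ S, a i ≤ 1) {η : ℝ} (hη : 0 ≤ η)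
    (hl : η ≤ a i) (hr : η ≤ 1 - a i)
    (E : Set (Set ι)) :
    η * bernoulliProb S a {A | insert i A ∈ E ∨ A \ {i} ∈ E} ≤ bernoulliProb S a E := by
  obtain ⟨S, hiS, rfl⟩ : ∃ S', i ∉ S' ∧ insert i S' = S :=
    ⟨S.erase i, Finset.notMem_erase i S, Finset.insert_erase hi⟩
  have h0' : ∀ j ∈ S, 0 ≤ a j := fun j hj => h0 j (Finset.mem_insert_of_mem hj)
  have h1' : ∀ j ∈ S, a j ≤ 1 := fun j hj => h1 j (Finset.mem_insert_of_mem hj)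
  rw [bernoulliProb_insert hiS, bernoulliProb_insert hiS]
  have e1 : {A : Set ι | insert i A ∈ {A : Set ι | insert i A ∈ E ∨ A \ {i} ∈ E}} =
      {A | insert i A ∈ E ∨ A \ {i} ∈ E} := by
    ext A
    simp
  have e2 : bernoulliProb S a {A : Set ι | A \ {i} ∈ E} = bernoulliProb S a E :=
    bernoulliProb_congr_event fun A hA => by
      rw [Set.mem_ofPred_eq, Set.sdiff_singleton_eq_self fun h => hiS (by exact_mod_cast hA h)]
  have e3 := bernoulliProb_union_le h0' h1' {A : Set ι | insert i A ∈ E} {A : Set ι | A \ {i} ∈ E}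
  rw [e2, ← Set.ofPred_or] at e3
  rw [e1]
  have n1 := bernoulliProb_nonneg h0' h1' {A : Set ι | insert i A ∈ E}
  have n2 := bernoulliProb_nonneg h0' h1' E
  calc η * (a i * bernoulliProb S a {A | insert i A ∈ E ∨ A \ {i} ∈ E} +
        (1 - a i) * bernoulliProb S a {A | insert i A ∈ E ∨ A \ {i} ∈ E})
      = η * bernoulliProb S a {A | insert i A ∈ E ∨ A \ {i} ∈ E} := by ring
    _ ≤ η * (bernoulliProb S a {A : Set ι | insert i A ∈ E} + bernoulliProb S a E) := by gcongr
    _ ≤ _ := by nlinarith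

/-- Changing the states of finitely many coordinates has bounded cost. -/
lemma pow_mul_bernoulliProb_modify_le {N S : Finset ι} (hNS : N ⊆ S) {a : ι → ℝ}
    (h0 : ∀ i ∈ S, 0 ≤ a i) (h1 : ∀ i ∈ S, a i ≤ 1) {η : ℝ} (hη : 0 ≤ η)
    (hl : ∀ i ∈ N, η ≤ a i) (hr : ∀ i ∈ N, η ≤ 1 - a i) {E F : Set (Set ι)}
    (h : ∀ A ∈ E, ∃ B ∈ F, ∀ i ∉ N, i ∈ A ↔ i ∈ B) :
    η ^ N.card * bernoulliProb S a E ≤ bernoulliProb S a F := by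
  induction N using Finset.induction_on generalizing F with
  | empty =>
    simp only [Finset.card_empty, pow_zero, one_mul]
    refine bernoulliProb_mono h0 h1 fun A _ _ _ hA => ?_
    obtain ⟨B, hB, hAB⟩ := h A hA
    rwa [show A = B from Set.ext fun i => hAB i (Finset.notMem_empty i)]
  | insert i N hi ih =>
    have step := mul_bernoulliProb_modify_le (hNS (Finset.mem_insert_self i N)) h0 h1 hη
      (hl i (Finset.mem_insert_self i N)) (hr i (Finset.mem_insert_self i N)) F
    have := ih (F := {A | insert i A ∈ F ∨ A \ {i} ∈ F})
      ((Finset.subset_insert i N).trans hNS) (fun j hj => hl j (Finset.mem_insert_of_mem hj))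
      (fun j hj => hr j (Finset.mem_insert_of_mem hj)) (fun A hA => ?_)
    · rw [Finset.card_insert_of_notMem hi, pow_succ']
      nlinarith
    · obtain ⟨B, hB, hAB⟩ := h A hA
      by_cases hiB : i ∈ B
      · refine ⟨B \ {x | x = i ∧ i ∉ A}, Or.inl ?_, fun j hj => ?_⟩
        · convert hB using 1
          ext j
          by_cases hji : j = i <;> simp [hji, hiB]
        · by_cases hji : j = i
          · subst hji; simp [hiB]
          · simp [hji, hAB j (by simp [hji, hj])]
      · refine ⟨B ∪ {x | x = i ∧ i ∈ A}, Or.inr ?_, fun j hj => ?_⟩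
        · convert hB using 1
          ext j
          by_cases hji : j = i <;> simp [hji, hiB]
        · by_cases hji : j = i
          · subst hji; simp [hiB]
          · simp [hji, hAB j (by simp [hji, hj])]

lemma bernoulliProb_pivotalEvent {S : Finset ι} {i : ι} (hi : i ∉ S) (a : ι → ℝ)
    {E : Set (Set ι)} (hE : IsUpperSet E) :
    bernoulliProb S a (pivotalEvent i E) =
      bernoulliProb S a {A | insert i A ∈ E} - bernoulliProb S a E := by
  unfold bernoulliProb
  rw [← Finset.sum_sub_distrib]
  refine Finset.sum_congr rfl fun A hA => ?_
  have hiA : i ∉ (A : Set ι) := fun h => hi (Finset.mem_powerset.1 hA (by exact_mod_cast h))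
  have himp : (A : Set ι) ∈ E → insert i (A : Set ι) ∈ E := fun h => hE (Set.subset_insert i _) h
  rw [← mul_sub]
  congr 1
  simp only [pivotalEvent, Set.mem_ofPred_eq, Set.sdiff_singleton_eq_self hiA]
  by_cases h1 : (A : Set ι) ∈ E
  · simp [h1, himp h1]
  · simp [h1]

/-- Russo's formula. -/
lemma hasDerivAt_bernoulliProb {S : Finset ι} {a : ℝ → ι → ℝ} {a' : ι → ℝ} {t : ℝ}
    (ha : ∀ i ∈ S, HasDerivAt (fun t => a t i) (a' i) t) {E : Set (Set ι)} (hE : IsUpperSet E) :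
    HasDerivAt (fun t => bernoulliProb S (a t) E)
      (∑ i ∈ S, a' i * bernoulliProb S (a t) (pivotalEvent i E)) t := by
  induction S using Finset.induction_on generalizing E with
  | empty =>
    simp only [bernoulliProb_empty, Finset.sum_empty]
    exact hasDerivAt_const _ _
  | insert i S hi ih =>
    have ha' : ∀ j ∈ S, HasDerivAt (fun t => a t j) (a' j) t :=
      fun j hj => ha j (Finset.mem_insert_of_mem hj)
    have hai := ha i (Finset.mem_insert_self i S)
    simp only [bernoulliProb_insert hi]
    have d1 := ih ha' (isUpperSet_insert_mem hE i)
    have d2 := ih ha' hE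
    refine ((hai.mul d1).add ((hai.const_sub 1).mul d2)).congr_deriv ?_
    rw [Finset.sum_insert hi]
    have e1 : {A : Set ι | insert i A ∈ pivotalEvent i E} = pivotalEvent i E := by
      ext A
      simp [pivotalEvent]
    have e2 : ∀ j ∈ S, {A : Set ι | insert i A ∈ pivotalEvent j E} =
        pivotalEvent j {A | insert i A ∈ E} := by
      intro j hj
      have hij : i ≠ j := fun h => hi (h ▸ hj)
      ext A
      simp only [pivotalEvent, Set.mem_ofPred_eq]
      rw [Set.insert_comm, Set.insert_sdiff_singleton_comm hij]
    have e3 : ∀ j ∈ S, a' j * (a t i * bernoulliProb S (a t) {A | insert i A ∈ pivotalEvent j E} +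
        (1 - a t i) * bernoulliProb S (a t) (pivotalEvent j E)) =
        a t i * (a' j * bernoulliProb S (a t) (pivotalEvent j {A | insert i A ∈ E})) +
        (1 - a t i) * (a' j * bernoulliProb S (a t) (pivotalEvent j E)) := by
      intro j hj
      rw [e2 j hj]
      ring
    rw [e1, bernoulliProb_pivotalEvent hi _ hE, Finset.sum_congr rfl e3, Finset.sum_add_distrib,
      ← Finset.mul_sum, ← Finset.mul_sum]
    ring

/-- Splitting off from each edge of `K` an independent sub-edge of parameter `ε`. -/
lemma le_bernoulliProb_of_split {S : Finset ι} {E : Set (Set ι)} (hE : IsUpperSet E) {ε : ℝ}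
    (hε0 : 0 ≤ ε) (hε1 : ε ≤ 1) (K : Finset ι) (hKS : K ⊆ S) {a : ι → ℝ} (h0 : ∀ i, 0 ≤ a i)
    (h1 : ∀ i, a i ≤ 1) (hK : ∀ i ∈ K, ε ≤ a i) :
    ε ^ K.card * bernoulliProb S (fun i => if i ∈ K then 1 else a i) E +
      (1 - ε ^ K.card) * bernoulliProb S (fun i => if i ∈ K then a i - ε else a i) E ≤
      bernoulliProb S a E := by
  induction K using Finset.induction_on generalizing a with
  | empty => simp
  | insert i K hi ih =>
    have hiS := hKS (Finset.mem_insert_self i K)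
    have hKS' : K ⊆ S := (Finset.subset_insert i K).trans hKS
    have hia := hK i (Finset.mem_insert_self i K)
    have hK' : ∀ j ∈ K, ε ≤ a j := fun j hj => hK j (Finset.mem_insert_of_mem hj)
    have hne : ∀ j ∈ K, j ≠ i := fun j hj h => hi (h ▸ hj)
    have hlow : bernoulliProb S (Function.update a i (a i - ε)) E =
        a i * bernoulliProb S (Function.update a i 1) E +
        (1 - a i) * bernoulliProb S (Function.update a i 0) E -
        ε * (bernoulliProb S (Function.update a i 1) E -
          bernoulliProb S (Function.update a i 0) E) := by
      rw [bernoulliProb_eq_update hiS]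
      simp only [Function.update_self, Function.update_idem]
      ring
    have hmono := bernoulliProb_update_le (i := i) (S := S) h0 h1 hE le_rfl zero_le_one le_rfl
    have hup := bernoulliProb_eq_update hiS a E
    have hup0 : ∀ j, 0 ≤ Function.update a i 1 j := fun j => by
      rcases eq_or_ne j i with rfl | hj
      · simp
      · simp [hj, h0]
    have hup1 : ∀ j, Function.update a i 1 j ≤ 1 := fun j => by
      rcases eq_or_ne j i with rfl | hj
      · simp
      · simp [hj, h1]
    have ih1 := ih hKS' hup0 hup1 fun j hj => by
      rw [Function.update_of_ne (hne j hj)]; exact hK' j hj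
    have c1 : (fun j => if j ∈ K then 1 else Function.update a i 1 j) =
        fun j => if j ∈ insert i K then 1 else a j := by
      ext j
      rcases eq_or_ne j i with rfl | hj
      · simp
      · simp [hj]
    rw [c1] at ih1
    have c2 : bernoulliProb S (fun j => if j ∈ insert i K then a j - ε else a j) E ≤
        bernoulliProb S (fun j => if j ∈ K then Function.update a i 1 j - ε
          else Function.update a i 1 j) E := by
      refine bernoulliProb_le_of_le (fun j _ => ?_) (fun j _ => ?_) (fun j _ => ?_) hE
      · split_ifs with h
        · linarith [hK j h]
        · exact h0 j
      · split_ifs with h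
        · linarith [hup1 j]
        · exact hup1 j
      · rcases eq_or_ne j i with rfl | hj
        · simp only [Finset.mem_insert_self, if_true, hi, if_false, Function.update_self]
          linarith [h1 j]
        · simp [hj]
    have c3 : bernoulliProb S (fun j => if j ∈ insert i K then a j - ε else a j) E ≤
        bernoulliProb S (Function.update a i (a i - ε)) E := by
      refine bernoulliProb_le_of_le (fun j _ => ?_) (fun j _ => ?_) (fun j _ => ?_) hE
      · split_ifs with h
        · linarith [hK j h]
        · exact h0 j
      · rcases eq_or_ne j i with rfl | hj
        · simp only [Function.update_self]
          linarith [h1 j]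
        · simp [hj, h1]
      · rcases eq_or_ne j i with rfl | hj
        · simp
        · simp only [Finset.mem_insert, hj, false_or, Function.update_of_ne hj]
          split_ifs <;> linarith
    set X := bernoulliProb S (fun j => if j ∈ insert i K then 1 else a j) E
    set Y := bernoulliProb S (fun j => if j ∈ insert i K then a j - ε else a j) E
    set Z := bernoulliProb S (fun j => if j ∈ K then Function.update a i 1 j - ε
          else Function.update a i 1 j) E
    set P := bernoulliProb S (Function.update a i 1) E
    set Q := bernoulliProb S (Function.update a i 0) E
    have hk0 : 0 ≤ ε ^ K.card := pow_nonneg hε0 _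
    have hk1 : ε ^ K.card ≤ 1 := pow_le_one₀ hε0 hε1
    rw [Finset.card_insert_of_notMem hi, pow_succ', hup]
    have s1 : ε * (ε ^ K.card * X + (1 - ε ^ K.card) * Z) ≤ ε * P :=
      mul_le_mul_of_nonneg_left ih1 hε0
    have s2 : ε * ((1 - ε ^ K.card) * Y) ≤ ε * ((1 - ε ^ K.card) * Z) := by gcongr
    have s3 : (1 - ε) * Y ≤ (1 - ε) * (a i * P + (1 - a i) * Q - ε * (P - Q)) := by
      rw [← hlow]; gcongr
    nlinarith [mul_nonneg (mul_nonneg hε0 (sub_nonneg.2 hia)) (sub_nonneg.2 hmono)]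

end BernoulliProb

section Reachability

variable {V : Type*}

lemma Relation.ReflTransGen.of_imp {r p : V → V → Prop} {a b : V}
    (h : Relation.ReflTransGen r a b) (hrp : ∀ u v, r u v → p u v) :
    Relation.ReflTransGen p a b :=
  Relation.ReflTransGen.mono hrp _ _ h

lemma reflTransGen_last_exit {r : V → V → Prop} (B : Set V) {o t : V}
    (h : Relation.ReflTransGen r o t) (ht : t ∉ B) :
    Relation.ReflTransGen (fun u v => r u v ∧ u ∉ B ∧ v ∉ B) o t ∨
      ∃ b ∈ B, ∃ c ∉ B, r b c ∧ Relation.ReflTransGen (fun u v => r u v ∧ u ∉ B ∧ v ∉ B) c t := by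
  induction h with
  | refl => exact Or.inl .refl
  | @tail y z _ hyz ih =>
    by_cases hy : y ∈ B
    · exact Or.inr ⟨y, hy, z, ht, hyz, .refl⟩
    · rcases ih hy with ih | ⟨b, hb, c, hc, hbc, ih⟩
      · exact Or.inl (ih.tail ⟨hyz, hy, ht⟩)
      · exact Or.inr ⟨b, hb, c, hc, hbc, ih.tail ⟨hyz, hy, ht⟩⟩

lemma reflTransGen_first_entry {r : V → V → Prop} (B : Set V) {o t : V}
    (h : Relation.ReflTransGen r o t) (ho : o ∉ B) :
    (Relation.ReflTransGen (fun u v => r u v ∧ u ∉ B ∧ v ∉ B) o t ∧ t ∉ B) ∨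
      ∃ i ∉ B, ∃ u ∈ B, r i u ∧ Relation.ReflTransGen (fun u v => r u v ∧ u ∉ B ∧ v ∉ B) o i := by
  induction h with
  | refl => exact Or.inl ⟨.refl, ho⟩
  | @tail y z _ hyz ih =>
    rcases ih with ⟨ih, hy⟩ | ih
    · by_cases hz : z ∈ B
      · exact Or.inr ⟨y, hy, z, hz, hyz, ih⟩
      · exact Or.inl ⟨ih.tail ⟨hyz, hy, hz⟩, hz⟩
    · exact Or.inr ih

lemma exists_adj_dist_eq {G : SimpleGraph V} (hG : G.Connected) {x z : V} {k : ℕ}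
    (h : G.dist x z = k + 1) : ∃ w, G.Adj w z ∧ G.dist x w = k := by
  obtain ⟨p, hp⟩ := hG.exists_walk_length_eq_dist z x
  rw [SimpleGraph.dist_comm, h] at hp
  cases p with
  | nil => simp at hp
  | @cons _ w _ hzw q =>
    refine ⟨w, hzw.symm, le_antisymm ?_ ?_⟩
    · rw [SimpleGraph.dist_comm]
      exact (SimpleGraph.dist_le q).trans (by simpa using hp.le)
    · have := hG.dist_triangle (u := x) (v := w) (w := z)
      rw [h, SimpleGraph.dist_eq_one_iff_adj.2 hzw.symm] at this
      omega

lemma dist_le_succ_of_adj {G : SimpleGraph V} (hG : G.Connected) (x : V) {w z : V}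
    (h : G.Adj w z) : G.dist x z ≤ G.dist x w + 1 := by
  have := hG.dist_triangle (u := x) (v := w) (w := z)
  rwa [SimpleGraph.dist_eq_one_iff_adj.2 h] at this

lemma exists_ball {G : SimpleGraph V} (hG : G.Connected)
    (hlf : ∀ v : V, (G.neighborSet v).Finite)
    (hbd : ∃ D : ℕ, ∀ v : V, (G.neighborSet v).ncard ≤ D) (r : ℕ) :
    ∃ (f : V → Finset V) (M : ℕ), (∀ x y, y ∈ f x ↔ G.dist x y ≤ r) ∧ ∀ x, (f x).card ≤ M := by
  obtain ⟨D, hD⟩ := hbd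
  induction r with
  | zero =>
    refine ⟨fun x => {x}, 1, fun x y => ?_, fun x => by simp⟩
    rw [Finset.mem_singleton, Nat.le_zero, hG.dist_eq_zero_iff, eq_comm]
  | succ r ih =>
    obtain ⟨f, M, hf, hM⟩ := ih
    refine ⟨fun x => f x ∪ (f x).biUnion fun w => (hlf w).toFinset, M + M * D,
      fun x y => ?_, fun x => ?_⟩
    · simp only [Finset.mem_union, Finset.mem_biUnion, hf, Set.Finite.mem_toFinset,
        SimpleGraph.mem_neighborSet]
      constructor
      · rintro (h | ⟨w, hw, hwy⟩)
        · omega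
        · exact (dist_le_succ_of_adj hG x hwy).trans (by omega)
      · intro h
        rcases Nat.lt_or_ge (G.dist x y) (r + 1) with h' | h'
        · exact Or.inl (by omega)
        · obtain ⟨w, hwy, hw⟩ := exists_adj_dist_eq hG (le_antisymm h h')
          exact Or.inr ⟨w, hw.le, hwy⟩
    · refine (Finset.card_union_le _ _).trans (Nat.add_le_add (hM x) ?_)
      refine (Finset.card_biUnion_le_card_mul _ _ D fun w _ => ?_).trans
        (Nat.mul_le_mul_right D (hM x))
      rw [← Set.ncard_eq_toFinset_card _ (hlf w)]
      exact hD w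

/-- The event that the open edges of `G` connect `o` to the set `T`. -/
def connEvent (G : SimpleGraph V) (o : V) (T : Set V) : Set (Set (Sym2 V)) :=
  {A | ∃ t ∈ T, Relation.ReflTransGen (fun u v => G.Adj u v ∧ s(u, v) ∈ A) o t}

lemma isUpperSet_connEvent (G : SimpleGraph V) (o : V) (T : Set V) :
    IsUpperSet (connEvent G o T) := by
  rintro A B hAB ⟨t, ht, h⟩
  exact ⟨t, ht, h.of_imp fun u v huv => ⟨huv.1, hAB huv.2⟩⟩

/-- A step of the enhanced exploration: either cross an open edge, or, from a vertex whose
enhancement coordinate is open and whose ball of radius `L` is fully open, jump to any vertex of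
the ball of radius `L + 1`. -/
def enhStep (H : SimpleGraph V) (L : ℕ) (A : Set (Sym2 V ⊕ V)) (u v : V) : Prop :=
  (H.Adj u v ∧ Sum.inl s(u, v) ∈ A) ∨
    (Sum.inr u ∈ A ∧
      (∀ w w', H.dist u w ≤ L → H.dist u w' ≤ L → H.Adj w w' → Sum.inl s(w, w') ∈ A) ∧
      H.dist u v ≤ L + 1)

/-- The event that the enhanced exploration started at `o` reaches distance `n`. -/
def enhEvent (H : SimpleGraph V) (L : ℕ) (o : V) (n : ℕ) : Set (Set (Sym2 V ⊕ V)) :=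
  {A | ∃ t, n ≤ H.dist o t ∧ Relation.ReflTransGen (enhStep H L A) o t}

lemma enhStep_mono {H : SimpleGraph V} {L : ℕ} {A B : Set (Sym2 V ⊕ V)} (hAB : A ⊆ B) {u v : V}
    (h : enhStep H L A u v) : enhStep H L B u v :=
  h.imp (fun h => ⟨h.1, hAB h.2⟩)
    fun h => ⟨hAB h.1, fun w w' hw hw' hww' => hAB (h.2.1 w w' hw hw' hww'), h.2.2⟩

lemma isUpperSet_enhEvent (H : SimpleGraph V) (L : ℕ) (o : V) (n : ℕ) :
    IsUpperSet (enhEvent H L o n) := by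
  rintro A B hAB ⟨t, ht, h⟩
  exact ⟨t, ht, h.of_imp fun u v => enhStep_mono hAB⟩

/-- The coordinates that are allowed to change in the local modification around `x`. -/
def modificationZone (H : SimpleGraph V) (L : ℕ) (x : V) : Set (Sym2 V ⊕ V) :=
  {i | (∃ u w, H.Adj u w ∧ H.dist x u ≤ L ∧ i = Sum.inl s(u, w)) ∨
    ∃ z, H.dist x z ≤ 2 * L + 1 ∧ i = Sum.inr z}

section

variable {H : SimpleGraph V} (hH : H.Connected) {L : ℕ} {x : V}

include hH in
/-- Away from the ball of radius `L` around `x`, the exploration does not depend on the edges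
touching this ball, provided that the enhancements around `x` are switched off. -/
lemma enhStep_of_agree {B C : Set (Sym2 V ⊕ V)}
    (hB : ∀ z, H.dist x z ≤ 2 * L + 1 → Sum.inr z ∉ B)
    (hBC : ∀ i, (∀ u w, H.Adj u w → H.dist x u ≤ L → i ≠ Sum.inl s(u, w)) → (i ∈ B ↔ i ∈ C))
    {u v : V} (h : enhStep H L B u v) (hu : ¬ H.dist x u ≤ L) (hv : ¬ H.dist x v ≤ L) :
    enhStep H L C u v := by
  have hedge : ∀ w w', ¬ H.dist x w ≤ L → ¬ H.dist x w' ≤ L → Sum.inl s(w, w') ∈ B →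
      Sum.inl s(w, w') ∈ C := by
    intro w w' hw hw' hB
    refine (hBC _ fun a b hab ha heq => ?_).1 hB
    rcases Sym2.eq_iff.1 (Sum.inl_injective heq) with ⟨rfl, rfl⟩ | ⟨rfl, rfl⟩
    · exact hw ha
    · exact hw' ha
  rcases h with ⟨hadj, hB'⟩ | ⟨hB', hball, hd⟩
  · exact Or.inl ⟨hadj, hedge u v hu hv hB'⟩
  · have hfar : 2 * L + 1 < H.dist x u := by
      by_contra hcon
      exact hB u (by omega) hB'
    have hout : ∀ w, H.dist u w ≤ L → ¬ H.dist x w ≤ L := by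
      intro w hw hxw
      have := hH.dist_triangle (u := x) (v := w) (w := u)
      rw [SimpleGraph.dist_comm (u := w)] at this
      omega
    refine Or.inr ⟨(hBC _ fun a b _ _ => by simp).1 hB', fun w w' hw hw' hww' => ?_, hd⟩
    exact hedge w w' (hout w hw) (hout w' hw') (hball w w' hw hw' hww')

include hH in
/-- The exploration enters and leaves the ball around `x` only through open edges, provided that
the enhancements around `x` are switched off. -/
lemma enhStep_is_edge {B : Set (Sym2 V ⊕ V)}
    (hB : ∀ z, H.dist x z ≤ 2 * L + 1 → Sum.inr z ∉ B)
    {u v : V} (h : enhStep H L B u v) (huv : H.dist x u ≤ L ∨ H.dist x v ≤ L) :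
    H.Adj u v ∧ Sum.inl s(u, v) ∈ B := by
  rcases h with h | ⟨hB', -, hd⟩
  · exact h
  · exfalso
    refine hB u ?_ hB'
    rcases huv with hu | hv
    · omega
    · have := hH.dist_triangle (u := x) (v := v) (w := u)
      rw [SimpleGraph.dist_comm (u := v)] at this
      omega

include hH in
lemma reflTransGen_enhStep_center {C : Set (Sym2 V ⊕ V)}
    (hC : ∀ w w', H.dist x w ≤ L → H.dist x w' ≤ L → H.Adj w w' → Sum.inl s(w, w') ∈ C)
    {y : V} (hy : H.dist x y ≤ L) : Relation.ReflTransGen (enhStep H L C) y x := by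
  induction hk : H.dist x y generalizing y with
  | zero =>
    rw [hH.dist_eq_zero_iff.1 hk]
  | succ k ih =>
    obtain ⟨w, hwy, hw⟩ := exists_adj_dist_eq hH hk
    exact .head (Or.inl ⟨hwy.symm, hC y w hy (by omega) hwy.symm⟩) (ih (by omega) hw)

include hH in
/-- If an edge at `x` is pivotal, then a local modification makes some nearby enhancement
pivotal. -/
lemma exists_pivotal_enhancement (hfin : {z | H.dist x z ≤ 2 * L + 1}.Finite) {o v : V} {n : ℕ}
    (hn : H.dist o x + L < n) {A : Set (Sym2 V ⊕ V)}
    (hA : A ∈ pivotalEvent (Sum.inl s(x, v)) (enhEvent H L o n)) (hxv : H.Adj x v) :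
    ∃ z, H.dist x z ≤ 2 * L + 1 ∧ ∃ B ∈ pivotalEvent (Sum.inr z) (enhEvent H L o n),
      ∀ i ∉ modificationZone H L x, i ∈ A ↔ i ∈ B := by
  by_contra hcon
  have hup := isUpperSet_enhEvent H L o n
  have hirr : ∀ B : Set (Sym2 V ⊕ V), (∀ i ∉ modificationZone H L x, i ∈ A ↔ i ∈ B) →
      ∀ z, H.dist x z ≤ 2 * L + 1 → insert (Sum.inr z) B ∈ enhEvent H L o n →
        B \ {Sum.inr z} ∈ enhEvent H L o n := by
    intro B hB z hz hins
    by_contra hnot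
    exact hcon ⟨z, hz, B, ⟨hins, hnot⟩, hB⟩
  have hoff : ∀ B : Set (Sym2 V ⊕ V), (∀ i ∉ modificationZone H L x, i ∈ A ↔ i ∈ B) →
      B ∈ enhEvent H L o n →
      ∀ Z : Finset V, (∀ z ∈ Z, H.dist x z ≤ 2 * L + 1) →
        B \ {i | ∃ z ∈ Z, i = Sum.inr z} ∈ enhEvent H L o n := by
    intro B hB hBE Z
    induction Z using Finset.induction_on with
    | empty => intro _; simpa using hBE
    | insert z Z hz ih =>
      intro hZ
      have ih := ih fun z hz => hZ z (Finset.mem_insert_of_mem hz)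
      have := hirr _ (fun i hi => ?_) z (hZ z (Finset.mem_insert_self z Z))
        (hup (Set.subset_insert _ _) ih)
      · convert this using 1
        ext i
        simp only [Set.mem_sdiff, Set.mem_ofPred_eq, Finset.mem_insert, Set.mem_singleton_iff,
          not_exists, not_and]
        constructor
        · exact fun h => ⟨⟨h.1, fun z hz => h.2 z (Or.inr hz)⟩, h.2 z (Or.inl rfl)⟩
        · rintro ⟨⟨h1, h2⟩, h3⟩
          refine ⟨h1, fun y hy => ?_⟩
          rcases hy with rfl | hy
          · exact h3
          · exact h2 y hy
      · rw [hB i hi]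
        simp only [Set.mem_sdiff, Set.mem_ofPred_eq, not_exists, not_and]
        refine ⟨fun h => ⟨h, ?_⟩, fun h => h.1⟩
        rintro y hy rfl
        exact hi (Or.inr ⟨y, hZ y (Finset.mem_insert_of_mem hy), rfl⟩)
  set near : Set (Sym2 V ⊕ V) := {i | ∃ z, H.dist x z ≤ 2 * L + 1 ∧ i = Sum.inr z} with hnear
  set A1 : Set (Sym2 V ⊕ V) := insert (Sum.inl s(x, v)) A \ near with hA1
  set A0 : Set (Sym2 V ⊕ V) := (A \ {Sum.inl s(x, v)}) \ near with hA0
  have hA1E : A1 ∈ enhEvent H L o n := by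
    have := hoff (insert (Sum.inl s(x, v)) A) (fun i hi => ?_) hA.1 hfin.toFinset (by simp)
    · convert this using 4
      simp
    · rw [Set.mem_insert_iff]
      refine ⟨Or.inr, fun h => h.resolve_left ?_⟩
      rintro rfl
      exact hi (Or.inl ⟨x, v, hxv, by simp, rfl⟩)
  have hA0E : A0 ∉ enhEvent H L o n := fun h => hA.2 (hup Set.sdiff_subset h)
  have hA1near : ∀ z, H.dist x z ≤ 2 * L + 1 → Sum.inr z ∉ A1 :=
    fun z hz h => h.2 ⟨z, hz, rfl⟩
  have h10 : ∀ i, (∀ u w, H.Adj u w → H.dist x u ≤ L → i ≠ Sum.inl s(u, w)) →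
      (i ∈ A1 ↔ i ∈ A0) := by
    intro i hi
    have := hi x v hxv (by simp)
    simp [hA1, hA0, this]
  have hnotball : ∀ t, n ≤ H.dist o t → t ∉ {y | H.dist x y ≤ L} := by
    intro t ht htx
    have := hH.dist_triangle (u := o) (v := x) (w := t)
    simp only [Set.mem_ofPred_eq] at htx
    omega
  obtain ⟨t, hnt, hpath⟩ := hA1E
  rcases reflTransGen_last_exit {y | H.dist x y ≤ L} hpath (hnotball t hnt) with
    hav | ⟨b, hb, j, hj, hbj, hjt⟩
  · exact hA0E ⟨t, hnt, hav.of_imp fun u w h => enhStep_of_agree hH hA1near h10 h.1 h.2.1 h.2.2⟩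
  have hbj' := enhStep_is_edge hH hA1near hbj (Or.inl hb)
  have hxj : H.dist x j ≤ L + 1 :=
    (dist_le_succ_of_adj hH x hbj'.1).trans (Nat.add_le_add_right hb 1)
  set touched : Set (Sym2 V ⊕ V) :=
    {i | ∃ u w, H.Adj u w ∧ H.dist x u ≤ L ∧ i = Sum.inl s(u, w)} with htouched
  set inside : Set (Sym2 V ⊕ V) :=
    {i | ∃ u w, H.Adj u w ∧ H.dist x u ≤ L ∧ H.dist x w ≤ L ∧ i = Sum.inl s(u, w)} with hinside
  -- Opening the ball and closing all its exits, except possibly for an entrance connected to `o`,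
  -- gives a contradiction.
  have main : ∀ X : Set (Sym2 V ⊕ V),
      (∀ i ∈ X, ∃ y w, H.Adj y w ∧ H.dist x w ≤ L ∧ ¬ H.dist x y ≤ L ∧ i = Sum.inl s(y, w) ∧
        Relation.ReflTransGen (fun u v => enhStep H L A1 u v ∧ u ∉ {y | H.dist x y ≤ L} ∧
          v ∉ {y | H.dist x y ≤ L}) o y) →
      Relation.ReflTransGen (enhStep H L (A1 \ touched ∪ inside ∪ X)) o x → False := by
    intro X hX hox
    set C := A1 \ touched ∪ inside ∪ X with hC
    have hXt : ∀ i ∈ X, i ∈ touched := by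
      intro i hi
      obtain ⟨y, w, hyw, hw, -, rfl, -⟩ := hX i hi
      exact ⟨w, y, hyw.symm, hw, by rw [Sym2.eq_swap]⟩
    have hit : ∀ i ∈ inside, i ∈ touched := by
      rintro i ⟨u, w, huw, hu, -, rfl⟩
      exact ⟨u, w, huw, hu, rfl⟩
    have hCnear : ∀ z, H.dist x z ≤ 2 * L + 1 → Sum.inr z ∉ C := by
      rintro z hz ((h | ⟨u, w, -, -, -, h⟩) | h)
      · exact hA1near z hz h.1
      · simp at h
      · obtain ⟨u, w, -, -, -, h, -⟩ := hX _ h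
        simp at h
    have hC1 : ∀ i, (∀ u w, H.Adj u w → H.dist x u ≤ L → i ≠ Sum.inl s(u, w)) →
        (i ∈ A1 ↔ i ∈ C) := by
      intro i hi
      have hit' : i ∉ touched := fun ⟨u, w, huw, hu, h⟩ => hi u w huw hu h
      have h1 : i ∉ inside := fun h => hit' (hit i h)
      have h2 : i ∉ X := fun h => hit' (hXt i h)
      simp [hC, hit', h1, h2]
    have hC0 : ∀ i, (∀ u w, H.Adj u w → H.dist x u ≤ L → i ≠ Sum.inl s(u, w)) →
        (i ∈ C ↔ i ∈ A0) := fun i hi => (hC1 i hi).symm.trans (h10 i hi)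
    have hCagree : ∀ i ∉ modificationZone H L x, i ∈ A ↔ i ∈ C := by
      intro i hi
      have hnt : ∀ u w, H.Adj u w → H.dist x u ≤ L → i ≠ Sum.inl s(u, w) :=
        fun u w huw hu h => hi (Or.inl ⟨u, w, huw, hu, h⟩)
      have hnn : i ∉ near := fun h => hi (Or.inr h)
      rw [← hC1 i hnt]
      simp [hA1, hnn, hnt x v hxv (by simp)]
    have hCE : insert (Sum.inr x) C ∈ enhEvent H L o n := by
      have hsub : C ⊆ insert (Sum.inr x) C := Set.subset_insert _ _
      refine ⟨t, hnt, ((hox.of_imp fun u v => enhStep_mono hsub).tail (b := x) (c := j) ?_).trans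
        (hjt.of_imp fun u w h => enhStep_mono hsub
          (enhStep_of_agree hH hA1near hC1 h.1 h.2.1 h.2.2))⟩
      refine Or.inr ⟨Set.mem_insert _ _, fun w w' hw hw' hww' => Set.mem_insert_of_mem _ ?_, hxj⟩
      exact Or.inl (Or.inr ⟨w, w', hww', hw, hw', rfl⟩)
    obtain ⟨t', hnt', hpath'⟩ := hup Set.sdiff_subset (hirr C hCagree x (by simp) hCE)
    rcases reflTransGen_last_exit {y | H.dist x y ≤ L} hpath' (hnotball t' hnt') with
      hav | ⟨b', hb', c', hc', hbc', hct'⟩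
    · exact hA0E ⟨t', hnt', hav.of_imp fun u w h => enhStep_of_agree hH hCnear hC0 h.1 h.2.1 h.2.2⟩
    · obtain ⟨hadj, hmem⟩ := enhStep_is_edge hH hCnear hbc' (Or.inl hb')
      rcases hmem with (h | ⟨u, w, -, hu, hw, h⟩) | h
      · exact h.2 ⟨b', c', hadj, hb', rfl⟩
      · rcases Sym2.eq_iff.1 (Sum.inl_injective h) with ⟨rfl, rfl⟩ | ⟨rfl, rfl⟩
        · exact hc' hw
        · exact hc' hu
      · obtain ⟨y, w, -, hw, hy, h, hoy⟩ := hX _ h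
        rcases Sym2.eq_iff.1 (Sum.inl_injective h) with ⟨rfl, rfl⟩ | ⟨rfl, rfl⟩
        · exact hy hb'
        · refine hA0E ⟨t', hnt', (hoy.of_imp fun u w h => ?_).trans (hct'.of_imp fun u w h => ?_)⟩
          · exact enhStep_of_agree hH hA1near h10 h.1 h.2.1 h.2.2
          · exact enhStep_of_agree hH hCnear hC0 h.1 h.2.1 h.2.2
  have hins : ∀ X : Set (Sym2 V ⊕ V), ∀ w w', H.dist x w ≤ L → H.dist x w' ≤ L → H.Adj w w' →
      Sum.inl s(w, w') ∈ A1 \ touched ∪ inside ∪ X :=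
    fun X w w' hw hw' hww' => Or.inl (Or.inr ⟨w, w', hww', hw, hw', rfl⟩)
  by_cases ho : H.dist x o ≤ L
  · exact main ∅ (by simp) (reflTransGen_enhStep_center hH (hins ∅) ho)
  · rcases reflTransGen_first_entry {y | H.dist x y ≤ L} hpath ho with ⟨hav, -⟩ |
      ⟨i, hi, u, hu, hiu, hoi⟩
    · exact hA0E ⟨t, hnt, hav.of_imp fun u w h => enhStep_of_agree hH hA1near h10 h.1 h.2.1 h.2.2⟩
    · have hiu' := enhStep_is_edge hH hA1near hiu (Or.inr hu)
      have hsub : A1 \ touched ⊆ A1 \ touched ∪ inside ∪ {Sum.inl s(i, u)} :=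
        fun k hk => Or.inl (Or.inl hk)
      refine main {Sum.inl s(i, u)} ?_ (((hoi.of_imp fun y w h => enhStep_mono hsub
        (enhStep_of_agree hH hA1near ?_ h.1 h.2.1 h.2.2)).tail
          (Or.inl ⟨hiu'.1, Or.inr rfl⟩)).trans (reflTransGen_enhStep_center hH (hins _) hu))
      · rintro k rfl
        exact ⟨i, u, hiu'.1, hu, hi, rfl, hoi⟩
      · intro k hk
        have : k ∉ touched := fun ⟨u, w, huw, hu, h⟩ => hk u w huw hu h
        simp [this]

end

end Reachability

lemma bernoulliProb_image {ι κ : Type*} [DecidableEq κ] {f : ι → κ} (hf : Function.Injective f) (S : Finset ι)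
    (a : κ → ℝ) (E : Set (Set κ)) :
    bernoulliProb (S.image f) a E = bernoulliProb S (fun i => a (f i)) {A | f '' A ∈ E} := by
  induction S using Finset.induction_on generalizing E with
  | empty => simp [bernoulliProb_empty]
  | insert i S hi ih =>
    have hi' : f i ∉ S.image f := by simpa [hf.eq_iff] using hi
    rw [Finset.image_insert, bernoulliProb_insert hi', bernoulliProb_insert hi, ih, ih]
    simp only [Set.mem_ofPred_eq, Set.image_insert_eq]

section Interpolation

variable {V : Type*} {H : SimpleGraph V}

/-- The edges that can influence the exploration before it reaches distance `m`. -/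
def explorationZone (H : SimpleGraph V) (L : ℕ) (o : V) (m : ℕ) : Set (Sym2 V ⊕ V) :=
  {i | ∃ x v, H.Adj x v ∧ H.dist o x < m + L ∧ i = Sum.inl s(x, v)}

lemma mem_enhEvent_iff_inter (hH : H.Connected) (L : ℕ) (o : V) (m : ℕ) (A : Set (Sym2 V ⊕ V)) :
    A ∈ enhEvent H L o m ↔
      A ∩ (explorationZone H L o m ∪ Set.range Sum.inr) ∈ enhEvent H L o m := by
  refine ⟨?_, fun h => isUpperSet_enhEvent H L o m Set.inter_subset_left h⟩
  rintro ⟨t, ht, h⟩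
  have step : ∀ u v, H.dist o u < m → enhStep H L A u v →
      enhStep H L (A ∩ (explorationZone H L o m ∪ Set.range Sum.inr)) u v := by
    rintro u v hu (⟨huv, hA⟩ | ⟨hA, hball, hd⟩)
    · exact Or.inl ⟨huv, hA, Or.inl ⟨u, v, huv, by omega, rfl⟩⟩
    · refine Or.inr ⟨⟨hA, Or.inr ⟨u, rfl⟩⟩, fun w w' hw hw' hww' => ⟨hball w w' hw hw' hww',
        Or.inl ⟨w, w', hww', ?_, rfl⟩⟩, hd⟩
      have := hH.dist_triangle (u := o) (v := u) (w := w)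
      omega
  by_cases ho : m ≤ H.dist o o
  · exact ⟨o, ho, .refl⟩
  rcases reflTransGen_first_entry {t | m ≤ H.dist o t} h ho with ⟨-, h'⟩ | ⟨i, hi, u, hu, hiu, hoi⟩
  · exact absurd ht h'
  · exact ⟨u, hu, (hoi.of_imp fun y w h => step y w (not_le.1 h.2.1) h.1).tail
      (step i u (not_le.1 hi) hiu)⟩

/-- The vertices of the ball `b`, and the pairs of such vertices. -/
noncomputable def ballCoords (b : Finset V) : Finset (Sym2 V ⊕ V) :=
  ((b ×ˢ b).image fun p => Sum.inl s(p.1, p.2)) ∪ b.image Sum.inr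

lemma card_ballCoords_le (b : Finset V) : (ballCoords b).card ≤ b.card * b.card + b.card := by
  refine (Finset.card_union_le _ _).trans (Nat.add_le_add ?_ Finset.card_image_le)
  exact Finset.card_image_le.trans (Finset.card_product _ _).le

lemma inl_mem_ballCoords {b : Finset V} {u v : V} (hu : u ∈ b) (hv : v ∈ b) :
    Sum.inl s(u, v) ∈ ballCoords b :=
  Finset.mem_union_left _ (Finset.mem_image.2 ⟨(u, v), Finset.mem_product.2 ⟨hu, hv⟩, rfl⟩)

lemma inr_mem_ballCoords {b : Finset V} {u : V} (hu : u ∈ b) : Sum.inr u ∈ ballCoords b :=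
  Finset.mem_union_right _ (Finset.mem_image_of_mem _ hu)

lemma ballCoords_mono {b c : Finset V} (h : b ⊆ c) : ballCoords b ⊆ ballCoords c :=
  Finset.union_subset_union (Finset.image_subset_image (Finset.product_subset_product h h))
    (Finset.image_subset_image h)

/-- The probability that an edge is pivotal is bounded by the probabilities that the nearby
enhancements are pivotal. -/
lemma pow_mul_bernoulliProb_pivotal_le (hH : H.Connected) {L : ℕ} {b : V → Finset V} {B : ℕ}
    (hb : ∀ x y, y ∈ b x ↔ H.dist x y ≤ 2 * L + 2) (hB : ∀ x, (b x).card ≤ B)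
    {S : Finset (Sym2 V ⊕ V)} {a : Sym2 V ⊕ V → ℝ} {η : ℝ} (hη : 0 ≤ η) (hη1 : η ≤ 1)
    (hl : ∀ i, η ≤ a i) (hr : ∀ i, η ≤ 1 - a i) {o x v : V} {n : ℕ} (hn : H.dist o x + L < n)
    (hxv : H.Adj x v) (hS : ballCoords (b x) ⊆ S) :
    η ^ (B * B + B) * bernoulliProb S a (pivotalEvent (Sum.inl s(x, v)) (enhEvent H L o n)) ≤
      ∑ z ∈ (b x).filter fun z => H.dist x z ≤ 2 * L + 1,
        bernoulliProb S a (pivotalEvent (Sum.inr z) (enhEvent H L o n)) := by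
  have h0 : ∀ i ∈ S, 0 ≤ a i := fun i _ => hη.trans (hl i)
  have h1 : ∀ i ∈ S, a i ≤ 1 := fun i _ => by linarith [hr i]
  refine le_trans ?_ (bernoulliProb_biUnion_le h0 h1 _ _)
  refine le_trans ?_ (pow_mul_bernoulliProb_modify_le hS h0 h1 hη (fun i _ => hl i)
    (fun i _ => hr i) (E := pivotalEvent (Sum.inl s(x, v)) (enhEvent H L o n)) ?_)
  · refine mul_le_mul_of_nonneg_right (pow_le_pow_of_le_one hη hη1 ?_) (bernoulliProb_nonneg h0 h1 _)
    exact (card_ballCoords_le _).trans (Nat.add_le_add (Nat.mul_le_mul (hB x) (hB x)) (hB x))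
  · intro A hA
    have hfin : {z | H.dist x z ≤ 2 * L + 1}.Finite :=
      (b x).finite_toSet.subset fun z (hz : H.dist x z ≤ 2 * L + 1) => (hb x z).2 (by omega)
    obtain ⟨z, hz, A', hA', hAA'⟩ := exists_pivotal_enhancement hH hfin hn hA hxv
    refine ⟨A', Set.mem_biUnion (x := z) ?_ hA', fun i hi => hAA' i fun hi' => hi ?_⟩
    · exact Finset.mem_coe.2 (Finset.mem_filter.2 ⟨(hb x z).2 (by omega), hz⟩)
    · rcases hi' with ⟨u, w, huw, hu, rfl⟩ | ⟨z, hz, rfl⟩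
      · have := dist_le_succ_of_adj hH x huw
        exact inl_mem_ballCoords ((hb x u).2 (by omega)) ((hb x w).2 (by omega))
      · exact inr_mem_ballCoords ((hb x z).2 (by omega))

/-- The total influence of the edges is bounded by the total influence of the enhancements. -/
lemma pow_mul_sum_pivotal_le (hH : H.Connected) {L : ℕ} {b : V → Finset V} {B : ℕ}
    (hb : ∀ x y, y ∈ b x ↔ H.dist x y ≤ 2 * L + 2) (hB : ∀ x, (b x).card ≤ B)
    {S F : Finset (Sym2 V ⊕ V)} {Z : Finset V} {a : Sym2 V ⊕ V → ℝ} {η : ℝ} (hη : 0 ≤ η)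
    (hη1 : η ≤ 1) (hl : ∀ i, η ≤ a i) (hr : ∀ i, η ≤ 1 - a i) {o : V} {n : ℕ}
    (hF : ∀ i ∈ F, ∃ x v, H.Adj x v ∧ H.dist o x + L < n ∧ i = Sum.inl s(x, v))
    (hZ : ∀ z, H.dist o z ≤ n + (2 * L + 2) → z ∈ Z) (hS : ballCoords Z ⊆ S) :
    η ^ (B * B + B) * ∑ i ∈ F, bernoulliProb S a (pivotalEvent i (enhEvent H L o n)) ≤
      (B * B : ℕ) * ∑ z ∈ Z, bernoulliProb S a (pivotalEvent (Sum.inr z) (enhEvent H L o n)) := by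
  have h0 : ∀ i ∈ S, 0 ≤ a i := fun i _ => hη.trans (hl i)
  have h1 : ∀ i ∈ S, a i ≤ 1 := fun i _ => by linarith [hr i]
  have : Nonempty V := ⟨o⟩
  choose! x v hxv hdist heq using hF
  have hbZ : ∀ i ∈ F, b (x i) ⊆ Z := by
    intro i hi y hy
    have := hH.dist_triangle (u := o) (v := x i) (w := y)
    have := (hb _ _).1 hy
    have := hdist i hi
    exact hZ y (by omega)
  calc η ^ (B * B + B) * ∑ i ∈ F, bernoulliProb S a (pivotalEvent i (enhEvent H L o n))
      ≤ ∑ i ∈ F, ∑ z ∈ Z, if H.dist (x i) z ≤ 2 * L + 1 then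
          bernoulliProb S a (pivotalEvent (Sum.inr z) (enhEvent H L o n)) else 0 := by
        rw [Finset.mul_sum]
        refine Finset.sum_le_sum fun i hi => ?_
        rw [← Finset.sum_filter]
        have := pow_mul_bernoulliProb_pivotal_le hH hb hB hη hη1 hl hr (hdist i hi) (hxv i hi)
          ((ballCoords_mono (hbZ i hi)).trans hS)
        rw [← heq i hi] at this
        exact this.trans (Finset.sum_le_sum_of_subset_of_nonneg
          (Finset.filter_subset_filter _ (hbZ i hi)) fun _ _ _ => bernoulliProb_nonneg h0 h1 _)
    _ = ∑ z ∈ Z, ((F.filter fun i => H.dist (x i) z ≤ 2 * L + 1).card : ℝ) *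
          bernoulliProb S a (pivotalEvent (Sum.inr z) (enhEvent H L o n)) := by
        rw [Finset.sum_comm]
        refine Finset.sum_congr rfl fun z _ => ?_
        rw [← Finset.sum_filter, Finset.sum_const, nsmul_eq_mul]
    _ ≤ (B * B : ℕ) *
          ∑ z ∈ Z, bernoulliProb S a (pivotalEvent (Sum.inr z) (enhEvent H L o n)) := by
        rw [Finset.mul_sum]
        refine Finset.sum_le_sum fun z _ =>
          mul_le_mul_of_nonneg_right ?_ (bernoulliProb_nonneg h0 h1 _)
        rw [Nat.cast_le]
        have hsub : (F.filter fun i => H.dist (x i) z ≤ 2 * L + 1) ⊆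
            ((b z ×ˢ b z).image fun p => Sum.inl s(p.1, p.2)) := by
          intro i hi
          rw [Finset.mem_filter, SimpleGraph.dist_comm] at hi
          have := dist_le_succ_of_adj hH z (hxv i hi.1)
          rw [Finset.mem_image]
          exact ⟨(x i, v i), Finset.mem_product.2 ⟨(hb z (x i)).2 (by omega),
            (hb z (v i)).2 (by omega)⟩, (heq i hi.1).symm⟩
        refine (Finset.card_le_card hsub).trans (Finset.card_image_le.trans ?_)
        rw [Finset.card_product]
        exact Nat.mul_le_mul (hB z) (hB z)

/-- Adding a small density of enhancements allows one to decrease the density of edges. -/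
theorem exists_interpolation (hH : H.Connected) (hlf : ∀ v : V, (H.neighborSet v).Finite)
    (hbd : ∃ D : ℕ, ∀ v : V, (H.neighborSet v).ncard ≤ D) (L : ℕ) {lo hi s : ℝ} (hlo : 0 < lo)
    (hlohi : lo ≤ hi) (hhi : hi < 1) (hs0 : 0 < s) (hs1 : s < 1) :
    ∃ δ > 0, δ ≤ lo / 2 ∧ ∀ q, lo ≤ q → q ≤ hi → ∀ (o : V) (m : ℕ) (S : Finset (Sym2 V)),
      ∃ S' : Finset (Sym2 V ⊕ V),
        bernoulliProb S (fun _ => q) (connEvent H o {t | m + (2 * L + 1) ≤ H.dist o t}) ≤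
          bernoulliProb S' (Sum.elim (fun _ => q - δ) fun _ => s) (enhEvent H L o m) := by
  obtain ⟨b, B, hb, hB⟩ := exists_ball hH hlf hbd (2 * L + 2)
  obtain ⟨η, hη0, hη1, hη2, hη3, hη4⟩ :
      ∃ η : ℝ, 0 < η ∧ η ≤ lo / 2 ∧ η ≤ 1 - hi ∧ η ≤ s / 2 ∧ η ≤ 1 - s :=
    ⟨min (min (lo / 2) (1 - hi)) (min (s / 2) (1 - s)), by
      simp only [lt_min_iff]; refine ⟨⟨?_, ?_⟩, ?_, ?_⟩ <;> linarith,
      (min_le_left _ _).trans (min_le_left _ _), (min_le_left _ _).trans (min_le_right _ _),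
      (min_le_right _ _).trans (min_le_left _ _), (min_le_right _ _).trans (min_le_right _ _)⟩
  set c : ℝ := η ^ (B * B + B) with hc
  have hc0 : 0 < c := pow_pos hη0 _
  set δ : ℝ := min (lo / 2) (s / 2 * c / ((B * B : ℕ) + 1)) with hδ
  have hδ0 : 0 < δ := lt_min (by linarith) (by positivity)
  have hδlo : δ ≤ lo / 2 := min_le_left _ _
  have hδB : δ * (B * B : ℕ) ≤ s / 2 * c := by
    have h : δ ≤ s / 2 * c / ((B * B : ℕ) + 1) := min_le_right _ _
    rw [le_div_iff₀ (by positivity)] at h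
    nlinarith
  refine ⟨δ, hδ0, hδlo, fun q hq1 hq2 o m S => ?_⟩
  set n := m + (2 * L + 1) with hn
  obtain ⟨bo, _, hbo, -⟩ := exists_ball hH hlf hbd (n + (2 * L + 2))
  set Z := bo o with hZ
  set S' : Finset (Sym2 V ⊕ V) := S.image Sum.inl ∪ ballCoords Z with hS'
  set far := explorationZone H L o m with hfar
  set base : Sym2 V ⊕ V → ℝ := Sum.elim (fun _ => q) fun _ => s / 2 with hbase
  set slope : Sym2 V ⊕ V → ℝ :=
    fun i => (if i ∈ far then -δ else 0) + Sum.elim (fun _ => 0) (fun _ => s / 2) i with hslope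
  set a : ℝ → Sym2 V ⊕ V → ℝ := fun t i => base i + t * slope i with ha
  have hnotfar : ∀ z, Sum.inr z ∉ far := by rintro z ⟨_, _, _, _, h⟩; simp at h
  have hbounds : ∀ t, 0 ≤ t → t ≤ 1 → ∀ i, η ≤ a t i ∧ η ≤ 1 - a t i := by
    intro t ht0 ht1 i
    rcases i with e | z
    · simp only [ha, hbase, hslope, Sum.elim_inl, add_zero]
      split_ifs
      · constructor <;> nlinarith
      · constructor <;> linarith
    · simp only [ha, hbase, hslope, Sum.elim_inr, if_neg (hnotfar z), zero_add]
      constructor <;> nlinarith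
  have hderiv : ∀ t, HasDerivAt (fun t => bernoulliProb S' (a t) (enhEvent H L o n))
      (∑ i ∈ S', slope i * bernoulliProb S' (a t) (pivotalEvent i (enhEvent H L o n))) t := by
    intro t
    refine hasDerivAt_bernoulliProb (fun i _ => ?_) (isUpperSet_enhEvent H L o n)
    simpa [ha] using ((hasDerivAt_id t).mul_const (slope i)).const_add (base i)
  have hpos : ∀ t, 0 ≤ t → t ≤ 1 → 0 ≤
      ∑ i ∈ S', slope i * bernoulliProb S' (a t) (pivotalEvent i (enhEvent H L o n)) := by
    intro t ht0 ht1
    have h0 : ∀ i ∈ S', 0 ≤ a t i := fun i _ => hη0.le.trans (hbounds t ht0 ht1 i).1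
    have h1 : ∀ i ∈ S', a t i ≤ 1 := fun i _ => by linarith [(hbounds t ht0 ht1 i).2]
    set P : Sym2 V ⊕ V → ℝ := fun i => bernoulliProb S' (a t) (pivotalEvent i (enhEvent H L o n))
    have hP : ∀ i, 0 ≤ P i := fun i => bernoulliProb_nonneg h0 h1 _
    have key := pow_mul_sum_pivotal_le hH hb hB (S := S') (F := S'.filter (· ∈ far)) (Z := Z)
      (a := a t) (o := o) (n := n) hη0.le (by linarith) (fun i => (hbounds t ht0 ht1 i).1)
      (fun i => (hbounds t ht0 ht1 i).2) (fun i hi => by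
        obtain ⟨x, v, hxv, hd, rfl⟩ := (Finset.mem_filter.1 hi).2
        exact ⟨x, v, hxv, by omega, rfl⟩) (fun z hz => (hbo o z).2 hz) Finset.subset_union_right
    have hsum : ∑ z ∈ Z, P (Sum.inr z) * (s / 2) ≤
        ∑ i ∈ S', Sum.elim (fun _ => 0) (fun _ => s / 2) i * P i := by
      calc ∑ z ∈ Z, P (Sum.inr z) * (s / 2)
          = ∑ i ∈ Z.image Sum.inr, Sum.elim (fun _ => 0) (fun _ => s / 2) i * P i := by
            rw [Finset.sum_image (Sum.inr_injective.injOn)]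
            exact Finset.sum_congr rfl fun z _ => by simp [mul_comm]
        _ ≤ _ := by
            refine Finset.sum_le_sum_of_subset_of_nonneg
              (Finset.subset_union_right.trans Finset.subset_union_right) fun i _ _ => ?_
            refine mul_nonneg ?_ (hP i)
            rcases i with e | z
            · exact le_rfl
            · exact (half_pos hs0).le
    simp only [hslope, add_mul, Finset.sum_add_distrib, ite_mul, zero_mul]
    rw [← Finset.sum_filter, ← Finset.mul_sum]
    rw [← Finset.sum_mul] at hsum
    have hQ : 0 ≤ ∑ z ∈ Z, P (Sum.inr z) := Finset.sum_nonneg fun z _ => hP _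
    set X := ∑ i ∈ S'.filter (· ∈ far), P i
    set Q := ∑ z ∈ Z, P (Sum.inr z)
    have key' : c * X ≤ (B * B : ℕ) * Q := key
    have h3 : c * (δ * X) ≤ c * (Q * (s / 2)) := by
      nlinarith [mul_le_mul_of_nonneg_left key' hδ0.le, mul_le_mul_of_nonneg_right hδB hQ]
    have h4 := le_of_mul_le_mul_left h3 hc0
    change 0 ≤ -δ * X + _
    linarith
  have hmono : bernoulliProb S' (a 0) (enhEvent H L o n) ≤
      bernoulliProb S' (a 1) (enhEvent H L o n) := by
    refine monotoneOn_of_deriv_nonneg (convex_Icc (0 : ℝ) 1)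
      (fun t _ => (hderiv t).continuousAt.continuousWithinAt)
      (fun t _ => (hderiv t).differentiableAt.differentiableWithinAt) (fun t ht => ?_)
      (Set.left_mem_Icc.2 zero_le_one) (Set.right_mem_Icc.2 zero_le_one) zero_le_one
    rw [interior_Icc] at ht
    rw [(hderiv t).deriv]
    exact hpos t ht.1.le ht.2.le
  have hb0 := hbounds 0 le_rfl zero_le_one
  have hb1 := hbounds 1 zero_le_one le_rfl
  refine ⟨S', le_trans ?_ (hmono.trans ?_)⟩
  · calc bernoulliProb S (fun _ => q) (connEvent H o {t | n ≤ H.dist o t})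
        ≤ bernoulliProb S (fun _ => q) {A | Sum.inl '' A ∈ enhEvent H L o n} := by
          refine bernoulliProb_mono (fun _ _ => by linarith) (fun _ _ => by linarith) ?_
          rintro A - - - ⟨t, ht, h⟩
          exact ⟨t, ht, h.of_imp fun u v huv => Or.inl ⟨huv.1, Set.mem_image_of_mem _ huv.2⟩⟩
      _ = bernoulliProb (S.image Sum.inl) (a 0) (enhEvent H L o n) := by
          rw [bernoulliProb_image Sum.inl_injective]
          exact bernoulliProb_congr (fun e _ => by simp [ha, hbase]) _
      _ ≤ _ := bernoulliProb_le_of_subset Finset.subset_union_left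
          (fun i => hη0.le.trans (hb0 i).1) (fun i => by linarith [(hb0 i).2])
          (isUpperSet_enhEvent H L o n)
  · calc bernoulliProb S' (a 1) (enhEvent H L o n)
        ≤ bernoulliProb S' (a 1) (enhEvent H L o m) := by
          refine bernoulliProb_mono (fun i _ => hη0.le.trans (hb1 i).1)
            (fun i _ => by linarith [(hb1 i).2]) ?_
          rintro A - - - ⟨t, ht, h⟩
          exact ⟨t, by omega, h⟩
      _ = _ := by
          refine bernoulliProb_congr_of_depends (mem_enhEvent_iff_inter hH L o m) fun i _ hi => ?_
          rcases hi with hi | ⟨z, rfl⟩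
          · have hi' : i ∈ far := hi
            obtain ⟨x, v, -, -, rfl⟩ := hi
            simp [ha, hbase, hslope, hi', sub_eq_add_neg]
          · simp [ha, hbase, hslope, hnotfar z]
      _ ≤ _ := le_rfl

end Interpolation

section Coupling

/-- The coordinate `i` has not been revealed: its parameter is neither `0` nor `1`. -/
def Unrevealed {ι : Type*} (b : ι → ℝ) (i : ι) : Prop := b i ≠ 0 ∧ b i ≠ 1

lemma unrevealed_update {ι : Type*} [DecidableEq ι] {b : ι → ℝ} {i j : ι} {c : ℝ}
    (hc : c = 0 ∨ c = 1) :
    Unrevealed (Function.update b i c) j ↔ j ≠ i ∧ Unrevealed b j := by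
  unfold Unrevealed
  rcases eq_or_ne j i with rfl | hj
  · rcases hc with rfl | rfl <;> simp
  · simp [hj]

lemma card_filter_unrevealed_update_lt {ι : Type*} [DecidableEq ι] {S : Finset ι} {b : ι → ℝ}
    {i : ι} {c : ℝ} (hc : c = 0 ∨ c = 1) (hi : i ∈ S) (hU : Unrevealed b i) :
    (S.filter (Unrevealed (Function.update b i c))).card < (S.filter (Unrevealed b)).card := by
  refine Finset.card_lt_card (Finset.ssubset_iff_of_subset ?_ |>.2 ⟨i, ?_, ?_⟩)
  · intro j hj
    rw [Finset.mem_filter, unrevealed_update hc] at hj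
    exact Finset.mem_filter.2 ⟨hj.1, hj.2.2⟩
  · exact Finset.mem_filter.2 ⟨hi, hU⟩
  · rw [Finset.mem_filter, unrevealed_update hc]
    exact fun h => h.2.1 rfl

variable {VG VH : Type*}

/-- The vertices connected to `o` by edges of parameter `1`. -/
def openCluster (G : SimpleGraph VG) (a : Sym2 VG → ℝ) (o : VG) : Set VG :=
  {y | Relation.ReflTransGen (fun u v => G.Adj u v ∧ a s(u, v) = 1) o y}

lemma openCluster_mono {G : SimpleGraph VG} {a a' : Sym2 VG → ℝ} (h : ∀ e, a e = 1 → a' e = 1)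
    (o : VG) : openCluster G a o ⊆ openCluster G a' o :=
  fun _ hy => Relation.ReflTransGen.of_imp hy fun _ _ huv => ⟨huv.1, h _ huv.2⟩

lemma openCluster_tail {G : SimpleGraph VG} {a : Sym2 VG → ℝ} {o x y : VG}
    (hx : x ∈ openCluster G a o) (hxy : G.Adj x y) (h : a s(x, y) = 1) :
    y ∈ openCluster G a o :=
  Relation.ReflTransGen.tail hx ⟨hxy, h⟩

lemma exists_bernoulliProb_connEvent_eq_one {G : SimpleGraph VG} {a : Sym2 VG → ℝ}
    (h0 : ∀ e, 0 ≤ a e) (h1 : ∀ e, a e ≤ 1) {o t : VG} {T : Set VG} (ht : t ∈ T)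
    (hot : t ∈ openCluster G a o) :
    ∃ S₀ : Finset (Sym2 VG), ∀ S, S₀ ⊆ S → 1 ≤ bernoulliProb S a (connEvent G o T) := by
  have : ∃ S₀ : Finset (Sym2 VG), Relation.ReflTransGen
      (fun u v => G.Adj u v ∧ a s(u, v) = 1 ∧ s(u, v) ∈ S₀) o t := by
    clear ht
    induction hot with
    | refl => exact ⟨∅, .refl⟩
    | @tail y z _ hyz ih =>
      obtain ⟨S₀, hS₀⟩ := ih
      refine ⟨insert s(y, z) S₀, (hS₀.of_imp fun u v h =>
        ⟨h.1, h.2.1, Finset.mem_insert_of_mem h.2.2⟩).tail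
          ⟨hyz.1, hyz.2, Finset.mem_insert_self _ _⟩⟩
  obtain ⟨S₀, hS₀⟩ := this
  refine ⟨S₀, fun S hS => ?_⟩
  rw [← bernoulliProb_univ S a]
  refine bernoulliProb_mono (fun e _ => h0 e) (fun e _ => h1 e) fun A _ _ hA _ => ?_
  exact ⟨t, ht, hS₀.of_imp fun u v h => ⟨h.1, hA _ (hS h.2.2) h.2.1⟩⟩

/-- The part of the parameter of an edge over `e` that has to be kept for the unrevealed
enhancements near `e`. -/
noncomputable def reserve (H : SimpleGraph VH) (L : ℕ) (ε : ℝ) (S : Finset (Sym2 VH ⊕ VH))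
    (b : Sym2 VH ⊕ VH → ℝ) (e : Sym2 VH) : ℝ :=
  ε * (1 + ((S.filter fun i => Unrevealed b i ∧
    ∃ x, i = Sum.inr x ∧ ∃ w ∈ e, H.dist x w ≤ L).card : ℝ))

section Reserve

variable {H : SimpleGraph VH} {L : ℕ} {ε : ℝ} {S : Finset (Sym2 VH ⊕ VH)}
  {b : Sym2 VH ⊕ VH → ℝ} {c : ℝ}

lemma le_reserve (hε : 0 ≤ ε) (e : Sym2 VH) : ε ≤ reserve H L ε S b e :=
  le_mul_of_one_le_right hε (by simp)

lemma reserve_update_inl (hc : c = 0 ∨ c = 1) (e e' : Sym2 VH) :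
    reserve H L ε S (Function.update b (Sum.inl e) c) e' = reserve H L ε S b e' := by
  unfold reserve
  congr 4
  refine Finset.filter_congr fun i _ => ?_
  rw [unrevealed_update hc]
  constructor
  · exact fun h => ⟨h.1.2, h.2⟩
  · rintro ⟨h, x, rfl, hx⟩
    exact ⟨⟨by simp, h⟩, x, rfl, hx⟩

lemma reserve_update_le (hε : 0 ≤ ε) (hc : c = 0 ∨ c = 1) (i : Sym2 VH ⊕ VH) (e : Sym2 VH) :
    reserve H L ε S (Function.update b i c) e ≤ reserve H L ε S b e := by
  unfold reserve
  gcongr with j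
  rw [unrevealed_update hc]
  exact fun h => h.2

lemma reserve_update_add_le (hε : 0 ≤ ε) (hc : c = 0 ∨ c = 1) {x : VH} (hx : Sum.inr x ∈ S)
    (hU : Unrevealed b (Sum.inr x)) {e : Sym2 VH} (he : ∃ w ∈ e, H.dist x w ≤ L) :
    reserve H L ε S (Function.update b (Sum.inr x) c) e + ε ≤ reserve H L ε S b e := by
  unfold reserve
  rw [← mul_add_one, add_assoc]
  refine mul_le_mul_of_nonneg_left (add_le_add_right ?_ _) hε
  rw [← Nat.cast_add_one, Nat.cast_le, Nat.add_one_le_iff]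
  refine Finset.card_lt_card (Finset.ssubset_iff_of_subset ?_ |>.2 ⟨Sum.inr x, ?_, ?_⟩)
  · intro j hj
    rw [Finset.mem_filter, unrevealed_update hc] at hj
    exact Finset.mem_filter.2 ⟨hj.1, hj.2.1.2, hj.2.2⟩
  · exact Finset.mem_filter.2 ⟨hx, hU, x, rfl, he⟩
  · rw [Finset.mem_filter, unrevealed_update hc]
    exact fun h => h.2.1.1 rfl

end Reserve

/-- The invariant of the exploration coupling the enhanced percolation on `H`, with parameters
`b`, to the percolation on `G`, with parameters `a`. -/
structure IsCoupled (G : SimpleGraph VG) (H : SimpleGraph VH) (π : VG → VH) (L : ℕ)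
    (p s ε : ℝ) (S : Finset (Sym2 VH ⊕ VH)) (o : VG) (b : Sym2 VH ⊕ VH → ℝ)
    (a : Sym2 VG → ℝ) : Prop where
  unrevealed_imp : ∀ i, Unrevealed b i → i ∈ S ∧ b i = Sum.elim (fun _ => p) (fun _ => s) i
  nonneg : ∀ e, 0 ≤ a e
  le_one : ∀ e, a e ≤ 1
  eq_of_unrevealed : ∀ e ∈ G.edgeSet, e.map π ∈ H.edgeSet →
    Unrevealed b (Sum.inl (e.map π)) → a e = p
  reserve_le : ∀ e ∈ G.edgeSet, (e.map π ∉ H.edgeSet ∨ b (Sum.inl (e.map π)) ≠ 0) →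
    reserve H L ε S b (e.map π) ≤ a e
  reserve_le_or : ∀ e ∈ G.edgeSet, ∀ e' ∈ G.edgeSet, e ≠ e' → e.map π = e'.map π →
    reserve H L ε S b (e.map π) ≤ a e ∨ reserve H L ε S b (e.map π) ≤ a e'
  mem_of_edge : ∀ u v, H.Adj u v → b (Sum.inl s(u, v)) = 1 → u ∈ π '' openCluster G a o
  mem_of_enh : ∀ x v, b (Sum.inr x) = 1 → H.dist x v ≤ L + 1 → v ∈ π '' openCluster G a o

namespace IsCoupled

variable {G : SimpleGraph VG} {H : SimpleGraph VH} {π : VG → VH} {L : ℕ} {p s ε : ℝ}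
  {S : Finset (Sym2 VH ⊕ VH)} {o : VG} {b : Sym2 VH ⊕ VH → ℝ} {a : Sym2 VG → ℝ}

lemma initial (hp0 : 0 ≤ p) (hp1 : p < 1) (hs1 : s < 1)
    (hres : ∀ b e, reserve H L ε S b e ≤ p) :
    IsCoupled G H π L p s ε S o
      (fun i => if i ∈ S then Sum.elim (fun _ => p) (fun _ => s) i else 0) (fun _ => p) where
  unrevealed_imp i hi := by
    by_cases h : i ∈ S
    · simp [h]
    · simp [Unrevealed, h] at hi
  nonneg _ := hp0
  le_one _ := hp1.le
  eq_of_unrevealed _ _ _ _ := rfl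
  reserve_le _ _ _ := hres _ _
  reserve_le_or _ _ _ _ _ _ := Or.inl (hres _ _)
  mem_of_edge u v _ h := by
    split_ifs at h
    · simp only [Sum.elim_inl] at h
      linarith
    · simp at h
  mem_of_enh x v h _ := by
    split_ifs at h
    · simp only [Sum.elim_inr] at h
      linarith
    · simp at h

lemma update_edge (h : IsCoupled G H π L p s ε S o b a) (hp1 : p ≤ 1)
    (hres : ∀ b e, reserve H L ε S b e ≤ p) {x y : VG} (hxy : G.Adj x y)
    (hπ : H.Adj (π x) (π y)) (hx : x ∈ openCluster G a o)
    (hU : Unrevealed b (Sum.inl s(π x, π y))) {c : ℝ} (hc : c = 0 ∨ c = 1) :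
    IsCoupled G H π L p s ε S o (Function.update b (Sum.inl s(π x, π y)) c)
      (Function.update a s(x, y) c) := by
  have haxy : a s(x, y) = p := h.eq_of_unrevealed s(x, y) hxy hπ hU
  have hc0 : 0 ≤ c := by rcases hc with rfl | rfl <;> simp
  have hc1 : c ≤ 1 := by rcases hc with rfl | rfl <;> simp
  have hne : a s(x, y) ≠ 1 := by
    have hb : b (Sum.inl s(π x, π y)) = p := (h.unrevealed_imp _ hU).2
    rw [haxy, ← hb]
    exact hU.2
  have hcl : openCluster G a o ⊆ openCluster G (Function.update a s(x, y) c) o := by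
    refine openCluster_mono (fun e he => ?_) o
    rw [Function.update_of_ne, he]
    rintro rfl
    exact hne he
  have hother : ∀ e, e.map π ≠ s(π x, π y) → e ≠ s(x, y) := by
    rintro e he rfl
    exact he rfl
  refine ⟨fun i hi => ?_, fun e => ?_, fun e => ?_, fun e he heH hUe => ?_, fun e he hbe => ?_,
    fun e he e' he' hee' hπee' => ?_, fun u v huv hb => ?_, fun z v hb hd => ?_⟩
  · rw [unrevealed_update hc] at hi
    rw [Function.update_of_ne hi.1]
    exact h.unrevealed_imp i hi.2
  · rcases eq_or_ne e s(x, y) with rfl | he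
    · simpa using hc0
    · simpa [he] using h.nonneg e
  · rcases eq_or_ne e s(x, y) with rfl | he
    · simpa using hc1
    · simpa [he] using h.le_one e
  · rw [unrevealed_update hc] at hUe
    rw [Function.update_of_ne (hother e fun h => hUe.1 (by rw [h]))]
    exact h.eq_of_unrevealed e he heH hUe.2
  · rw [reserve_update_inl hc]
    rcases eq_or_ne e s(x, y) with rfl | hexy
    · rcases hc with rfl | rfl
      · rcases hbe with hbe | hbe
        · exact absurd hπ hbe
        · simp at hbe
      · rw [Function.update_self]
        exact (hres _ _).trans hp1
    · rw [Function.update_of_ne hexy]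
      rcases eq_or_ne (e.map π) s(π x, π y) with heq | hneq
      · refine h.reserve_le e he (Or.inr ?_)
        rw [heq]
        exact hU.1
      · refine h.reserve_le e he (hbe.imp_right fun hbe => ?_)
        rwa [Function.update_of_ne (by simpa using hneq)] at hbe
  · rw [reserve_update_inl hc]
    rcases eq_or_ne (e.map π) s(π x, π y) with heq | hneq
    · have hp : ∀ e'' ∈ G.edgeSet, e''.map π = e.map π → e'' ≠ s(x, y) →
          reserve H L ε S b (e.map π) ≤ Function.update a s(x, y) c e'' := by
        intro e'' he'' hee'' hne''
        rw [Function.update_of_ne hne'', h.eq_of_unrevealed e'' he'']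
        · exact hres _ _
        · rw [hee'', heq]
          exact hπ
        · rwa [hee'', heq]
      rcases eq_or_ne e s(x, y) with rfl | hexy
      · exact Or.inr (hp e' he' hπee'.symm hee'.symm)
      · exact Or.inl (hp e he rfl hexy)
    · rw [Function.update_of_ne (hother e hneq), Function.update_of_ne (hother e' (hπee' ▸ hneq))]
      exact h.reserve_le_or e he e' he' hee' hπee'
  · rcases eq_or_ne s(u, v) s(π x, π y) with heq | hneq
    · rw [heq, Function.update_self] at hb
      rcases Sym2.eq_iff.1 heq with ⟨rfl, rfl⟩ | ⟨rfl, rfl⟩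
      · exact ⟨x, hcl hx, rfl⟩
      · exact ⟨y, openCluster_tail (hcl hx) hxy (by simp [hb]), rfl⟩
    · rw [Function.update_of_ne (by simpa using hneq)] at hb
      exact Set.image_mono hcl (h.mem_of_edge u v huv hb)
  · rw [Function.update_of_ne (by simp)] at hb
    exact Set.image_mono hcl (h.mem_of_enh z v hb hd)

/-- If the ball of radius `L` around a reached vertex is fully open, then the exploration reaches
this ball. -/
lemma mem_of_ball (hH : H.Connected) (h : IsCoupled G H π L p s ε S o b a) {x : VH}
    (hx : x ∈ π '' openCluster G a o)
    (hball : ∀ w w', H.dist x w ≤ L → H.dist x w' ≤ L → H.Adj w w' → b (Sum.inl s(w, w')) = 1)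
    {w : VH} (hw : H.dist x w ≤ L) : w ∈ π '' openCluster G a o := by
  rcases Nat.eq_zero_or_pos (H.dist x w) with h0 | hpos
  · rwa [← hH.dist_eq_zero_iff.1 h0]
  · obtain ⟨w', hww', hw'⟩ := exists_adj_dist_eq hH (k := H.dist x w - 1) (x := x) (z := w) (by omega)
    exact h.mem_of_edge w w' hww'.symm (hball w w' hw (by omega) hww'.symm)

/-- If the exploration cannot continue and has not reached distance `m`, then the enhanced
percolation does not reach distance `m`. -/
lemma bernoulliProb_le_zero (hH : H.Connected) (h : IsCoupled G H π L p s ε S o b a)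
    (hp0 : 0 ≤ p) (hp1 : p ≤ 1) (hs0 : 0 ≤ s) (hs1 : s ≤ 1) {m : ℕ}
    (hT : ∀ y ∈ openCluster G a o, ¬ m ≤ H.dist (π o) (π y))
    (hedge : ∀ u v, u ∈ π '' openCluster G a o → H.Adj u v → ¬ Unrevealed b (Sum.inl s(u, v)))
    (henh : ∀ x ∈ π '' openCluster G a o, Unrevealed b (Sum.inr x) →
      ¬ ∀ w w', H.dist x w ≤ L → H.dist x w' ≤ L → H.Adj w w' → b (Sum.inl s(w, w')) = 1) :
    bernoulliProb S b (enhEvent H L (π o) m) ≤ 0 := by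
  have hb : ∀ i, 0 ≤ b i ∧ b i ≤ 1 := by
    intro i
    by_cases hU : Unrevealed b i
    · rw [(h.unrevealed_imp i hU).2]
      rcases i with e | x
      · exact ⟨hp0, hp1⟩
      · exact ⟨hs0, hs1⟩
    · rw [Unrevealed, not_and_or, not_not, not_not] at hU
      rcases hU with hU | hU <;> simp [hU]
  have hempty : bernoulliProb S b ∅ = 0 := by simp [bernoulliProb]
  rw [← hempty]
  refine bernoulliProb_mono (fun i _ => (hb i).1) (fun i _ => (hb i).2) ?_
  rintro A hAS hA0 - ⟨t, ht, hpath⟩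
  have hne : ∀ i ∈ A, b i ≠ 0 := fun i hi h0 => hA0 i (hAS hi) h0 hi
  have hone : ∀ u v, u ∈ π '' openCluster G a o → H.Adj u v → Sum.inl s(u, v) ∈ A →
      b (Sum.inl s(u, v)) = 1 := fun u v hu huv hA =>
    not_not.1 fun h1 => hedge u v hu huv ⟨hne _ hA, h1⟩
  have hnext : ∀ u v, u ∈ π '' openCluster G a o → H.Adj u v → Sum.inl s(u, v) ∈ A →
      v ∈ π '' openCluster G a o := by
    intro u v hu huv hA
    refine h.mem_of_edge v u huv.symm ?_
    rw [Sym2.eq_swap]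
    exact hone u v hu huv hA
  have hreach : t ∈ π '' openCluster G a o := by
    clear ht
    induction hpath with
    | refl => exact ⟨o, Relation.ReflTransGen.refl, rfl⟩
    | @tail u v _ huv ih =>
      rcases huv with ⟨huv, hA⟩ | ⟨hA, hball, hd⟩
      · exact hnext u v ih huv hA
      · by_cases hU : Unrevealed b (Sum.inr u)
        · exfalso
          have hin : ∀ k w, H.dist u w = k → k ≤ L → w ∈ π '' openCluster G a o := by
            intro k
            induction k with
            | zero =>
              intro w hw _
              rwa [← hH.dist_eq_zero_iff.1 hw]
            | succ k ihk =>
              intro w hw hk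
              obtain ⟨w', hww', hw'⟩ := exists_adj_dist_eq hH hw
              exact hnext w' w (ihk w' hw' (by omega)) hww'
                (hball w' w (by omega) (by omega) hww')
          exact henh u ih hU fun w w' hw hw' hww' =>
            hone w w' (hin _ w rfl hw) hww' (hball w w' hw hw' hww')
        · exact h.mem_of_enh u v (not_not.1 fun h1 => hU ⟨hne _ hA, h1⟩) hd
  obtain ⟨y, hy, rfl⟩ := hreach
  exact hT y hy ht

lemma update_enh_zero (h : IsCoupled G H π L p s ε S o b a) (hε : 0 < ε) {K : Finset (Sym2 VG)}
    {x : VH} (hK : ∀ e ∈ K, (∃ w ∈ e.map π, H.dist x w ≤ L) ∧ a e ≠ 1 ∧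
      reserve H L ε S b (e.map π) ≤ a e)
    (hU : Unrevealed b (Sum.inr x))
    (htouch : ∀ e ∈ H.edgeSet, (∃ w ∈ e, H.dist x w ≤ L) → ¬ Unrevealed b (Sum.inl e)) :
    IsCoupled G H π L p s ε S o (Function.update b (Sum.inr x) 0)
      (fun e => if e ∈ K then a e - ε else a e) := by
  have hcl : openCluster G a o ⊆ openCluster G (fun e => if e ∈ K then a e - ε else a e) o := by
    refine openCluster_mono (fun e he => ?_) o
    rw [if_neg fun heK => (hK e heK).2.1 he, he]
  have hres : ∀ e, reserve H L ε S b (e.map π) ≤ a e →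
      reserve H L ε S (Function.update b (Sum.inr x) 0) (e.map π) ≤
        if e ∈ K then a e - ε else a e := by
    intro e he
    split_ifs with heK
    · linarith [reserve_update_add_le hε.le (c := 0) (Or.inl rfl) (h.unrevealed_imp _ hU).1 hU
        (hK e heK).1]
    · exact (reserve_update_le hε.le (Or.inl rfl) _ _).trans he
  refine ⟨fun i hi => ?_, fun e => ?_, fun e => ?_, fun e he heH hUe => ?_, fun e he hbe => ?_,
    fun e he e' he' hee' hπee' => ?_, fun u v huv hb => ?_, fun z v hb hd => ?_⟩
  · rw [unrevealed_update (Or.inl rfl)] at hi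
    rw [Function.update_of_ne hi.1]
    exact h.unrevealed_imp i hi.2
  · split_ifs with heK
    · linarith [le_reserve (H := H) (L := L) (S := S) (b := b) hε.le (e.map π), (hK e heK).2.2]
    · exact h.nonneg e
  · split_ifs with heK
    · linarith [h.le_one e]
    · exact h.le_one e
  · rw [unrevealed_update (Or.inl rfl)] at hUe
    rw [if_neg fun heK => htouch _ heH (hK e heK).1 hUe.2]
    exact h.eq_of_unrevealed e he heH hUe.2
  · rw [Function.update_of_ne (by simp)] at hbe
    exact hres e (h.reserve_le e he hbe)
  · refine (h.reserve_le_or e he e' he' hee' hπee').imp (hres e) fun h' => ?_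
    rw [hπee'] at h' ⊢
    exact hres e' h'
  · rw [Function.update_of_ne (by simp)] at hb
    exact Set.image_mono hcl (h.mem_of_edge u v huv hb)
  · rcases eq_or_ne z x with rfl | hzx
    · simp at hb
    · rw [Function.update_of_ne (by simpa using hzx)] at hb
      exact Set.image_mono hcl (h.mem_of_enh z v hb hd)

lemma update_enh_one (h : IsCoupled G H π L p s ε S o b a) (hε : 0 < ε)
    (hp1 : p ≤ 1) (hres : ∀ b e, reserve H L ε S b e ≤ p) {K : Finset (Sym2 VG)}
    {x : VH} (hK : ∀ e ∈ K, ∃ w ∈ e.map π, H.dist x w ≤ L)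
    (htouch : ∀ e ∈ H.edgeSet, (∃ w ∈ e, H.dist x w ≤ L) → ¬ Unrevealed b (Sum.inl e))
    (hcover : ∀ v, H.dist x v ≤ L + 1 →
      v ∈ π '' openCluster G (fun e => if e ∈ K then 1 else a e) o) :
    IsCoupled G H π L p s ε S o (Function.update b (Sum.inr x) 1)
      (fun e => if e ∈ K then 1 else a e) := by
  have hcl : openCluster G a o ⊆ openCluster G (fun e => if e ∈ K then 1 else a e) o :=
    openCluster_mono (fun e he => by rw [he, ite_self]) o
  have hres : ∀ e, reserve H L ε S b (e.map π) ≤ a e →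
      reserve H L ε S (Function.update b (Sum.inr x) 1) (e.map π) ≤
        if e ∈ K then 1 else a e := by
    intro e he
    split_ifs with heK
    · exact (hres _ _).trans hp1
    · exact (reserve_update_le hε.le (Or.inr rfl) _ _).trans he
  refine ⟨fun i hi => ?_, fun e => ?_, fun e => ?_, fun e he heH hUe => ?_, fun e he hbe => ?_,
    fun e he e' he' hee' hπee' => ?_, fun u v huv hb => ?_, fun z v hb hd => ?_⟩
  · rw [unrevealed_update (Or.inr rfl)] at hi
    rw [Function.update_of_ne hi.1]
    exact h.unrevealed_imp i hi.2
  · split_ifs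
    · exact zero_le_one
    · exact h.nonneg e
  · split_ifs
    · exact le_rfl
    · exact h.le_one e
  · rw [unrevealed_update (Or.inr rfl)] at hUe
    rw [if_neg fun heK => htouch _ heH (hK e heK) hUe.2]
    exact h.eq_of_unrevealed e he heH hUe.2
  · rw [Function.update_of_ne (by simp)] at hbe
    exact hres e (h.reserve_le e he hbe)
  · refine (h.reserve_le_or e he e' he' hee' hπee').imp (hres e) fun h' => ?_
    rw [hπee'] at h' ⊢
    exact hres e' h'
  · rw [Function.update_of_ne (by simp)] at hb
    exact Set.image_mono hcl (h.mem_of_edge u v huv hb)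
  · rcases eq_or_ne z x with rfl | hzx
    · exact hcover v hd
    · rw [Function.update_of_ne (by simpa using hzx)] at hb
      exact Set.image_mono hcl (h.mem_of_enh z v hb hd)

/-- Opening the edges with a sufficient reserve around `x` covers a ball of radius `L + 1`. -/
lemma cover (hG : G.Connected) (hH : H.Connected) (hcov : IsStrongCoveringMap G H π)
    (h : IsCoupled G H π L p s ε S o b a) {x : VG} (hx : x ∈ openCluster G a o)
    (hball : ∀ w w', H.dist (π x) w ≤ L → H.dist (π x) w' ≤ L → H.Adj w w' →
      b (Sum.inl s(w, w')) = 1)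
    (hfib : ∃ y, π x = π y ∧ 0 < G.dist x y ∧ G.dist x y ≤ L) {a' : Sym2 VG → ℝ}
    (ha' : ∀ e, a e = 1 → a' e = 1)
    (hgood : ∀ y y', G.Adj y y' → G.dist x y ≤ 2 * L + 1 → G.dist x y' ≤ 2 * L + 1 →
      H.dist (π x) (π y) ≤ L → reserve H L ε S b s(π y, π y') ≤ a s(y, y') → a' s(y, y') = 1)
    {v : VH} (hv : H.dist (π x) v ≤ L + 1) : v ∈ π '' openCluster G a' o := by
  have hstep : ∀ y y', G.Adj y y' → G.dist x y ≤ 2 * L + 1 → G.dist x y' ≤ 2 * L + 1 →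
      H.dist (π x) (π y) ≤ L → H.dist (π x) (π y') ≤ L → y ∈ openCluster G a' o →
      y' ∈ openCluster G a' o := by
    intro y y' hyy' hy hy' hπy hπy' hmem
    refine openCluster_tail hmem hyy' (hgood y y' hyy' hy hy' hπy ?_)
    refine h.reserve_le s(y, y') hyy' ?_
    by_cases hadj : H.Adj (π y) (π y')
    · refine Or.inr ?_
      have : b (Sum.inl s(π y, π y')) = 1 := hball _ _ hπy hπy' hadj
      change b (Sum.inl s(π y, π y')) ≠ 0
      rw [this]
      exact one_ne_zero
    · exact Or.inl hadj
  have hlip := hcov.1 x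
  have hxin : x ∈ openCluster G a' o := openCluster_mono ha' o hx
  have hnear : ∀ k y, G.dist x y = k → k ≤ L → y ∈ openCluster G a' o := by
    intro k
    induction k with
    | zero =>
      intro y hy _
      rwa [← hG.dist_eq_zero_iff.1 hy]
    | succ k ih =>
      intro y hy hk
      obtain ⟨w, hwy, hw⟩ := exists_adj_dist_eq hG hy
      have hw' := hlip w
      have hy' := hlip y
      exact hstep w y hwy (by omega) (by omega) (by omega) (by omega) (ih w hw (by omega))
  obtain ⟨y, hxy, hpos, hyL⟩ := hfib
  have hlift : ∀ w w₁ w₂, π w₁ = w → π w₂ = w → w₁ ≠ w₂ → ∀ u, H.Adj w u →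
      ∃ u₁ u₂, G.Adj w₁ u₁ ∧ G.Adj w₂ u₂ ∧ π u₁ = u ∧ π u₂ = u ∧ u₁ ≠ u₂ := by
    rintro w w₁ w₂ rfl hw₂ hne u hu
    obtain ⟨u₁, ⟨hu₁, hπu₁⟩, -⟩ := hcov.2 w₁ u hu
    obtain ⟨u₂, ⟨hu₂, hπu₂⟩, -⟩ := hcov.2 w₂ u (hw₂ ▸ hu)
    refine ⟨u₁, u₂, hu₁, hu₂, hπu₁, hπu₂, ?_⟩
    rintro rfl
    exact hne ((hcov.2 u₁ (π w₁) (hπu₁ ▸ hu.symm)).unique ⟨hu₁.symm, rfl⟩ ⟨hu₂.symm, hw₂⟩)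
  have htwo : ∀ k u, H.dist (π x) u = k → k ≤ L → ∃ u₁ u₂, u₁ ≠ u₂ ∧ π u₁ = u ∧ π u₂ = u ∧
      u₁ ∈ openCluster G a' o ∧ u₂ ∈ openCluster G a' o ∧ G.dist x u₁ ≤ L + k ∧
      G.dist x u₂ ≤ L + k := by
    intro k
    induction k with
    | zero =>
      intro u hu _
      refine ⟨x, y, ?_, hH.dist_eq_zero_iff.1 hu, ?_, hxin, hnear _ y rfl hyL, by simp, hyL⟩
      · rintro rfl
        simp at hpos
      · rw [← hxy]
        exact hH.dist_eq_zero_iff.1 hu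
    | succ k ih =>
      intro u hu hk
      obtain ⟨w, hwu, hw⟩ := exists_adj_dist_eq hH hu
      obtain ⟨w₁, w₂, hne, hπw₁, hπw₂, hw₁, hw₂, hd₁, hd₂⟩ := ih w hw (by omega)
      obtain ⟨u₁, u₂, hwu₁, hwu₂, hπu₁, hπu₂, hne'⟩ := hlift w w₁ w₂ hπw₁ hπw₂ hne u hwu
      have h₁ := dist_le_succ_of_adj hG x hwu₁
      have h₂ := dist_le_succ_of_adj hG x hwu₂
      refine ⟨u₁, u₂, hne', hπu₁, hπu₂, ?_, ?_, by omega, by omega⟩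
      · exact hstep w₁ u₁ hwu₁ (by omega) (by omega) (by rw [hπw₁]; omega) (by rw [hπu₁]; omega) hw₁
      · exact hstep w₂ u₂ hwu₂ (by omega) (by omega) (by rw [hπw₂]; omega) (by rw [hπu₂]; omega) hw₂
  rcases Nat.lt_or_ge L (H.dist (π x) v) with hLv | hLv
  · obtain ⟨w, hwv, hw⟩ := exists_adj_dist_eq hH (le_antisymm hv hLv)
    obtain ⟨w₁, w₂, hne, hπw₁, hπw₂, hw₁, hw₂, hd₁, hd₂⟩ := htwo L w hw le_rfl
    obtain ⟨v₁, v₂, hwv₁, hwv₂, hπv₁, hπv₂, -⟩ := hlift w w₁ w₂ hπw₁ hπw₂ hne v hwv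
    have h₁ := dist_le_succ_of_adj hG x hwv₁
    have h₂ := dist_le_succ_of_adj hG x hwv₂
    have hedge : s(w₁, v₁) ≠ s(w₂, v₂) := by
      intro heq
      rcases Sym2.eq_iff.1 heq with ⟨h, -⟩ | ⟨h, -⟩
      · exact hne h
      · rw [← hπw₁, ← hπv₂, h] at hwv
        exact hwv.ne rfl
    have hmap₁ : Sym2.map π s(w₁, v₁) = s(w, v) := by rw [Sym2.map_mk, hπw₁, hπv₁]
    have hmap₂ : Sym2.map π s(w₂, v₂) = s(w, v) := by rw [Sym2.map_mk, hπw₂, hπv₂]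
    rcases h.reserve_le_or s(w₁, v₁) hwv₁ s(w₂, v₂) hwv₂ hedge (hmap₁.trans hmap₂.symm) with
      hr | hr
    · exact ⟨v₁, openCluster_tail hw₁ hwv₁ (hgood w₁ v₁ hwv₁ (by omega) (by omega)
        (by rw [hπw₁]; omega) hr), hπv₁⟩
    · rw [hmap₁, ← hmap₂] at hr
      exact ⟨v₂, openCluster_tail hw₂ hwv₂ (hgood w₂ v₂ hwv₂ (by omega) (by omega)
        (by rw [hπw₂]; omega) hr), hπv₂⟩
  · obtain ⟨v₁, -, -, hπv₁, -, hv₁, -⟩ := htwo _ v rfl hLv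
    exact ⟨v₁, hv₁, hπv₁⟩

end IsCoupled

end Coupling

section Domination

variable {VG VH : Type*} {G : SimpleGraph VG} {H : SimpleGraph VH} {π : VG → VH} {L : ℕ}
  {p s ε : ℝ} {S : Finset (Sym2 VH ⊕ VH)} {o : VG}

lemma IsCoupled.exists_le (hG : G.Connected) (hH : H.Connected) (hcov : IsStrongCoveringMap G H π)
    (hfib : ∀ x, ∃ y, π x = π y ∧ 0 < G.dist x y ∧ G.dist x y ≤ L)
    {bG : VG → Finset VG} {B : ℕ} (hbG : ∀ x y, y ∈ bG x ↔ G.dist x y ≤ 2 * L + 1)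
    (hB : ∀ x, (bG x).card ≤ B) (hp0 : 0 ≤ p) (hp1 : p ≤ 1) (hε0 : 0 < ε) (hε1 : ε ≤ 1)
    (hs0 : 0 ≤ s) (hs : s ≤ ε ^ (B * B))
    (hres : ∀ b e, reserve H L ε S b e ≤ p) (m : ℕ) {b : Sym2 VH ⊕ VH → ℝ} {a : Sym2 VG → ℝ}
    (h : IsCoupled G H π L p s ε S o b a) :
    ∃ S₀ : Finset (Sym2 VG), ∀ S', S₀ ⊆ S' → bernoulliProb S b (enhEvent H L (π o) m) ≤
      bernoulliProb S' a (connEvent G o {y | m ≤ H.dist (π o) (π y)}) := by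
  have hs1 : s ≤ 1 := hs.trans (pow_le_one₀ hε0.le hε1)
  have hb01 : ∀ b a, IsCoupled G H π L p s ε S o b a → ∀ i, 0 ≤ b i ∧ b i ≤ 1 := by
    intro b a h i
    by_cases hU : Unrevealed b i
    · rw [(h.unrevealed_imp i hU).2]
      rcases i with e | x
      · exact ⟨hp0, hp1⟩
      · exact ⟨hs0, hs1⟩
    · rw [Unrevealed, not_and_or, not_not, not_not] at hU
      rcases hU with hU | hU <;> simp [hU]
  have hup := isUpperSet_connEvent G o {y | m ≤ H.dist (π o) (π y)}
  induction hk : (S.filter (Unrevealed b)).card using Nat.strong_induction_on generalizing b a with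
  | _ k ih =>
  subst hk
  by_cases hT : ∃ y ∈ openCluster G a o, m ≤ H.dist (π o) (π y)
  · obtain ⟨y, hy, hmy⟩ := hT
    obtain ⟨S₀, hS₀⟩ := exists_bernoulliProb_connEvent_eq_one (G := G) (o := o)
      (T := {y | m ≤ H.dist (π o) (π y)}) h.nonneg h.le_one hmy hy
    exact ⟨S₀, fun S' hS' => (bernoulliProb_le_one (fun i _ => (hb01 b a h i).1)
      (fun i _ => (hb01 b a h i).2) _).trans (hS₀ S' hS')⟩
  by_cases hedge : ∃ u v, u ∈ π '' openCluster G a o ∧ H.Adj u v ∧ Unrevealed b (Sum.inl s(u, v))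
  · obtain ⟨-, v, ⟨x, hx, rfl⟩, huv, hU⟩ := hedge
    obtain ⟨y, ⟨hxy, rfl⟩, -⟩ := hcov.2 x v huv
    obtain ⟨hiS, hbi⟩ := h.unrevealed_imp _ hU
    have haxy : a s(x, y) = p := h.eq_of_unrevealed s(x, y) hxy huv hU
    have hlt : ∀ c : ℝ, c = 0 ∨ c = 1 → _ := fun c hc =>
      ih _ (card_filter_unrevealed_update_lt hc hiS hU)
        (h.update_edge hp1 hres hxy huv hx hU hc) rfl
    obtain ⟨S₁, hS₁⟩ := hlt 1 (Or.inr rfl)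
    obtain ⟨S₂, hS₂⟩ := hlt 0 (Or.inl rfl)
    refine ⟨insert s(x, y) (S₁ ∪ S₂), fun S' hS' => ?_⟩
    rw [Finset.insert_subset_iff, Finset.union_subset_iff] at hS'
    rw [bernoulliProb_eq_update hiS, bernoulliProb_eq_update hS'.1, haxy, hbi]
    exact add_le_add (mul_le_mul_of_nonneg_left (hS₁ S' hS'.2.1) hp0)
      (mul_le_mul_of_nonneg_left (hS₂ S' hS'.2.2) (sub_nonneg.2 hp1))
  by_cases henh : ∃ x ∈ π '' openCluster G a o, Unrevealed b (Sum.inr x) ∧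
      ∀ w w', H.dist x w ≤ L → H.dist x w' ≤ L → H.Adj w w' → b (Sum.inl s(w, w')) = 1
  · obtain ⟨-, ⟨x, hx, rfl⟩, hU, hball⟩ := henh
    obtain ⟨hiS, hbi⟩ := h.unrevealed_imp _ hU
    have htouch : ∀ e ∈ H.edgeSet, (∃ w ∈ e, H.dist (π x) w ≤ L) →
        ¬ Unrevealed b (Sum.inl e) := by
      rintro e he ⟨w, hwe, hw⟩ hUe
      obtain ⟨w', rfl⟩ := Sym2.mem_iff_exists.1 hwe
      exact hedge ⟨w, w', h.mem_of_ball hH ⟨x, hx, rfl⟩ hball hw, he, hUe⟩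
    set K : Finset (Sym2 VG) := ((bG x ×ˢ bG x).image fun q => s(q.1, q.2)).filter fun e =>
      (∃ w ∈ e.map π, H.dist (π x) w ≤ L) ∧ a e ≠ 1 ∧ reserve H L ε S b (e.map π) ≤ a e with hKdef
    have hK : ∀ e ∈ K, (∃ w ∈ e.map π, H.dist (π x) w ≤ L) ∧ a e ≠ 1 ∧
        reserve H L ε S b (e.map π) ≤ a e := fun e he => (Finset.mem_filter.1 he).2
    have hcard : K.card ≤ B * B := by
      refine (Finset.card_filter_le _ _).trans (Finset.card_image_le.trans ?_)
      rw [Finset.card_product]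
      exact Nat.mul_le_mul (hB x) (hB x)
    have hcover : ∀ v, H.dist (π x) v ≤ L + 1 →
        v ∈ π '' openCluster G (fun e => if e ∈ K then 1 else a e) o := by
      intro v hv
      refine h.cover hG hH hcov hx hball (hfib x) (fun e he => by rw [he, ite_self]) ?_ hv
      intro y y' _ hy hy' hπy hr
      by_cases h1 : a s(y, y') = 1
      · rw [h1, ite_self]
      · refine if_pos (Finset.mem_filter.2 ⟨Finset.mem_image.2 ⟨(y, y'), ?_, rfl⟩, ?_, h1, hr⟩)
        · exact Finset.mem_product.2 ⟨(hbG x y).2 hy, (hbG x y').2 hy'⟩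
        · exact ⟨π y, Sym2.mem_mk_left _ _, hπy⟩
    have h1 := h.update_enh_one hε0 hp1 hres (fun e he => (hK e he).1) htouch hcover
    have h0 := h.update_enh_zero hε0 hK hU htouch
    obtain ⟨S₁, hS₁⟩ := ih _ (card_filter_unrevealed_update_lt (Or.inr rfl) hiS hU) h1 rfl
    obtain ⟨S₂, hS₂⟩ := ih _ (card_filter_unrevealed_update_lt (Or.inl rfl) hiS hU) h0 rfl
    refine ⟨K ∪ (S₁ ∪ S₂), fun S' hS' => ?_⟩
    rw [Finset.union_subset_iff, Finset.union_subset_iff] at hS'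
    have hsplit : ε ^ K.card * bernoulliProb S' (fun e => if e ∈ K then 1 else a e)
          (connEvent G o {y | m ≤ H.dist (π o) (π y)}) +
        (1 - ε ^ K.card) * bernoulliProb S' (fun e => if e ∈ K then a e - ε else a e)
          (connEvent G o {y | m ≤ H.dist (π o) (π y)}) ≤
        bernoulliProb S' a (connEvent G o {y | m ≤ H.dist (π o) (π y)}) := by
      convert le_bernoulliProb_of_split hup hε0.le hε1 K hS'.1 h.nonneg h.le_one
        fun e he => (le_reserve hε0.le _).trans (hK e he).2.2
    refine le_trans ?_ hsplit
    rw [bernoulliProb_eq_update hiS, hbi, Sum.elim_inr]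
    have hX := hS₁ S' hS'.2.1
    have hY := hS₂ S' hS'.2.2
    have hYX : bernoulliProb S' (fun e => if e ∈ K then a e - ε else a e)
        (connEvent G o {y | m ≤ H.dist (π o) (π y)}) ≤
        bernoulliProb S' (fun e => if e ∈ K then 1 else a e)
          (connEvent G o {y | m ≤ H.dist (π o) (π y)}) := by
      refine bernoulliProb_le_of_le (fun e _ => h0.nonneg e) (fun e _ => h1.le_one e)
        (fun e _ => ?_) hup
      split_ifs
      · linarith [h.le_one e]
      · exact le_rfl
    have hsK : s ≤ ε ^ K.card := hs.trans (pow_le_pow_of_le_one hε0.le hε1 hcard)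
    nlinarith [mul_le_mul_of_nonneg_left hX hs0, mul_le_mul_of_nonneg_left hY (sub_nonneg.2 hs1),
      mul_nonneg (sub_nonneg.2 hsK) (sub_nonneg.2 hYX)]
  refine ⟨∅, fun S' _ => ?_⟩
  refine (h.bernoulliProb_le_zero hH hp0 hp1 hs0 hs1 (fun y hy hmy => hT ⟨y, hy, hmy⟩)
    (fun u v hu huv hU => hedge ⟨u, v, hu, huv, hU⟩)
    (fun x hx hU hball => henh ⟨x, hx, hU, hball⟩)).trans ?_
  exact bernoulliProb_nonneg (fun e _ => h.nonneg e) (fun e _ => h.le_one e) _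

lemma reserve_le_of_card_le {bH : VH → Finset VH} {B : ℕ}
    (hbH : ∀ x y, y ∈ bH x ↔ H.dist x y ≤ L) (hB : ∀ x, (bH x).card ≤ B) (hε : 0 ≤ ε)
    (hp : ε * (1 + (B + B : ℕ)) ≤ p) (b : Sym2 VH ⊕ VH → ℝ) (e : Sym2 VH) :
    reserve H L ε S b e ≤ p := by
  refine le_trans ?_ hp
  unfold reserve
  gcongr
  induction e with | _ u v =>
  refine (Finset.card_le_card (t := (bH u ∪ bH v).image Sum.inr) ?_).trans
    (Finset.card_image_le.trans ((Finset.card_union_le _ _).trans (Nat.add_le_add (hB u) (hB v))))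
  intro i hi
  obtain ⟨-, -, x, rfl, w, hw, hxw⟩ := Finset.mem_filter.1 hi
  refine Finset.mem_image_of_mem _ ?_
  rw [SimpleGraph.dist_comm] at hxw
  rcases Sym2.mem_iff.1 hw with rfl | rfl
  · exact Finset.mem_union_left _ ((hbH _ _).2 hxw)
  · exact Finset.mem_union_right _ ((hbH _ _).2 hxw)

/-- The percolation on the covering graph dominates an enhanced percolation on the base graph. -/
theorem exists_enhancement_domination (hG : G.Connected)
    (hGlf : ∀ v : VG, (G.neighborSet v).Finite)
    (hGbd : ∃ D : ℕ, ∀ v : VG, (G.neighborSet v).ncard ≤ D) (hH : H.Connected)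
    (hHlf : ∀ v : VH, (H.neighborSet v).Finite)
    (hHbd : ∃ D : ℕ, ∀ v : VH, (H.neighborSet v).ncard ≤ D) (hcov : IsStrongCoveringMap G H π)
    (hfib : HasUniformlyNontrivialFibres G π) {lo : ℝ} (hlo0 : 0 < lo) (hlo1 : lo < 1) :
    ∃ (L : ℕ) (s : ℝ), 0 < s ∧ s < 1 ∧ ∀ p, lo ≤ p → p < 1 → ∀ (o : VG) (m : ℕ)
      (S : Finset (Sym2 VH ⊕ VH)), ∃ S' : Finset (Sym2 VG),
        bernoulliProb S (Sum.elim (fun _ => p) fun _ => s) (enhEvent H L (π o) m) ≤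
          bernoulliProb S' (fun _ => p) (connEvent G o {y | m ≤ H.dist (π o) (π y)}) := by
  obtain ⟨L, hL⟩ := hfib
  obtain ⟨bG, BG, hbG, hBG⟩ := exists_ball hG hGlf hGbd (2 * L + 1)
  obtain ⟨bH, BH, hbH, hBH⟩ := exists_ball hH hHlf hHbd L
  set ε : ℝ := lo / (1 + (BH + BH : ℕ)) with hε
  have hε0 : 0 < ε := by positivity
  have hεlo : ε * (1 + (BH + BH : ℕ)) = lo := div_mul_cancel₀ _ (by positivity)
  have hε1 : ε < 1 := (div_le_self hlo0.le (by simp)).trans_lt hlo1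
  refine ⟨L, ε ^ (BG * BG + 1), pow_pos hε0 _, pow_lt_one₀ hε0.le hε1 (by simp),
    fun p hp hp1 o m S => ?_⟩
  have hres := fun b e => reserve_le_of_card_le (H := H) (L := L) (p := p) (S := S) hbH hBH hε0.le
    (hεlo.le.trans hp) b e
  have hp0 : 0 ≤ p := hlo0.le.trans hp
  obtain ⟨S₀, hS₀⟩ := (IsCoupled.initial (G := G) (π := π) (o := o) hp0 hp1
    (pow_lt_one₀ hε0.le hε1 (by simp)) hres).exists_le hG hH hcov hL hbG hBG hp0 hp1.le hε0 hε1.le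
      (pow_nonneg hε0.le _) (pow_le_pow_of_le_one hε0.le hε1.le (Nat.le_succ _)) hres m
  refine ⟨S₀, le_trans (le_of_eq ?_) (hS₀ S₀ subset_rfl)⟩
  exact bernoulliProb_congr (fun i hi => (if_pos hi).symm) _

end Domination

section ProductMeasure

variable {ι : Type*} {p : ℝ}

lemma isProbabilityMeasure_bernoulliMeasure (h0 : 0 ≤ p) (h1 : p ≤ 1) :
    IsProbabilityMeasure (bernoulliMeasure p) := by
  constructor
  rw [bernoulliMeasure, Measure.add_apply, Measure.smul_apply, Measure.smul_apply,
    measure_univ, measure_univ, smul_eq_mul, smul_eq_mul, mul_one, mul_one,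
    ← ENNReal.ofReal_add h0 (by linarith)]
  simp

lemma bernoulliMeasure_singleton (p : ℝ) (b : Bool) :
    bernoulliMeasure p {b} = ENNReal.ofReal (if b = true then p else 1 - p) := by
  cases b <;> simp [bernoulliMeasure]

lemma bernoulliProduct_cylinder_le (h0 : 0 ≤ p) (h1 : p ≤ 1) (D : Finset ι) (A : Set ι) :
    bernoulliProduct ι p {ω | ∀ i ∈ D, ω i = true ↔ i ∈ A} ≤
      ENNReal.ofReal (∏ i ∈ D, if i ∈ A then p else 1 - p) := by
  have := isProbabilityMeasure_bernoulliMeasure h0 h1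
  refine (OuterMeasure.ofFunction_le _).trans ?_
  split_ifs
  · exact zero_le
  rw [tprod_eq_prod (s := D), ENNReal.ofReal_prod_of_nonneg]
  · refine Finset.prod_le_prod' fun i hi => ?_
    have hsub : Function.eval i '' {ω : ι → Bool | ∀ i ∈ D, ω i = true ↔ i ∈ A} ⊆
        {decide (i ∈ A)} := by
      rintro _ ⟨ω, hω, rfl⟩
      have := hω i hi
      rw [Set.mem_singleton_iff, Bool.eq_iff_iff, decide_eq_true_iff]
      exact this
    refine (measure_mono hsub).trans_eq ?_
    rw [bernoulliMeasure_singleton]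
    simp only [decide_eq_true_iff]
  · intro i _
    split_ifs
    · exact h0
    · linarith
  · intro i hi
    have : Function.eval i '' {ω : ι → Bool | ∀ i ∈ D, ω i = true ↔ i ∈ A} = Set.univ := by
      refine Set.eq_univ_of_forall fun b => ⟨Function.update (fun j => decide (j ∈ A)) i b, ?_, ?_⟩
      · intro j hj
        have hji : j ≠ i := fun h => hi (h ▸ hj)
        rw [Function.update_of_ne hji, decide_eq_true_iff]
      · simp
    rw [this, measure_univ]

/-- The configurations whose restriction to `D` belongs to `E`. -/
def restrictEvent (D : Finset ι) (E : Set (Set ι)) : Set (ι → Bool) :=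
  {ω | {i | i ∈ D ∧ ω i = true} ∈ E}

lemma bernoulliProduct_restrictEvent_le (h0 : 0 ≤ p) (h1 : p ≤ 1) (D : Finset ι)
    (E : Set (Set ι)) :
    bernoulliProduct ι p (restrictEvent D E) ≤
      ENNReal.ofReal (bernoulliProb D (fun _ => p) E) := by
  have hw : ∀ A : Finset ι, 0 ≤ ∏ i ∈ D, if i ∈ A then p else 1 - p := by
    refine fun A => Finset.prod_nonneg fun i _ => ?_
    split_ifs
    · exact h0
    · linarith
  have hcover : restrictEvent D E ⊆ ⋃ A ∈ D.powerset.filter fun A : Finset ι => (A : Set ι) ∈ E,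
      {ω : ι → Bool | ∀ i ∈ D, ω i = true ↔ i ∈ (A : Set ι)} := by
    intro ω hω
    simp only [Set.mem_iUnion]
    refine ⟨D.filter fun i => ω i = true, ?_, fun i hi => by simp [hi]⟩
    rw [Finset.mem_filter, Finset.mem_powerset]
    refine ⟨Finset.filter_subset _ _, ?_⟩
    rw [Finset.coe_filter]
    exact hω
  refine (measure_mono hcover).trans ((measure_biUnion_finset_le _ _).trans ?_)
  refine (Finset.sum_le_sum fun (A : Finset ι) _ =>
    bernoulliProduct_cylinder_le h0 h1 D (A : Set ι)).trans_eq ?_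
  unfold bernoulliProb
  simp only [mul_ite, mul_one, mul_zero, Finset.mem_coe]
  rw [← Finset.sum_filter, ENNReal.ofReal_sum_of_nonneg fun A _ => hw A]

lemma infinitePi_le_bernoulliProduct [IsProbabilityMeasure (bernoulliMeasure p)]
    (s : Set (ι → Bool)) :
    Measure.infinitePi (fun _ : ι => bernoulliMeasure p) s ≤ bernoulliProduct ι p s := by
  refine (OuterMeasure.le_ofFunction
    (μ := (Measure.infinitePi fun _ : ι => bernoulliMeasure p).toOuterMeasure)).2 (fun s => ?_) s
  split_ifs with hs
  · simp [hs]
  by_cases hm : Multipliable fun i => bernoulliMeasure p (Function.eval i '' s)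
  · refine le_hasProd_of_le_prod hm.hasProd fun D => ?_
    rw [← Measure.infinitePi_pi (fun _ : ι => bernoulliMeasure p)
      fun i _ => MeasurableSet.of_discrete]
    exact measure_mono fun ω hω i _ => ⟨ω, hω, rfl⟩
  · rw [tprod_eq_one_of_not_multipliable hm]
    exact prob_le_one

lemma bernoulliProb_add_compl (D : Finset ι) (a : ι → ℝ) (E : Set (Set ι)) :
    bernoulliProb D a E + bernoulliProb D a Eᶜ = 1 := by
  rw [← bernoulliProb_univ D a]
  unfold bernoulliProb
  rw [← Finset.sum_add_distrib]
  refine Finset.sum_congr rfl fun A _ => ?_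
  rw [← mul_add]
  by_cases h : (A : Set ι) ∈ E <;> simp [h]

lemma ofReal_bernoulliProb_le_infinitePi [IsProbabilityMeasure (bernoulliMeasure p)]
    (h0 : 0 ≤ p) (h1 : p ≤ 1) (D : Finset ι) (E : Set (Set ι)) :
    ENNReal.ofReal (bernoulliProb D (fun _ => p) E) ≤
      Measure.infinitePi (fun _ : ι => bernoulliMeasure p) (restrictEvent D E) := by
  set P := Measure.infinitePi fun _ : ι => bernoulliMeasure p
  have hsum := bernoulliProb_add_compl D (fun _ => p) E
  have hc : P (restrictEvent D E)ᶜ ≤ ENNReal.ofReal (bernoulliProb D (fun _ => p) Eᶜ) :=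
    (infinitePi_le_bernoulliProduct _).trans (bernoulliProduct_restrictEvent_le h0 h1 D Eᶜ)
  have hone : 1 ≤ P (restrictEvent D E) + P (restrictEvent D E)ᶜ := by
    rw [← measure_univ (μ := P), ← Set.union_compl_self (restrictEvent D E)]
    exact measure_union_le _ _
  have hn := bernoulliProb_nonneg (S := D) (a := fun _ => p) (fun _ _ => h0) (fun _ _ => h1)
  have : ENNReal.ofReal (bernoulliProb D (fun _ => p) E) +
      ENNReal.ofReal (bernoulliProb D (fun _ => p) Eᶜ) ≤
      P (restrictEvent D E) + ENNReal.ofReal (bernoulliProb D (fun _ => p) Eᶜ) := by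
    rw [← ENNReal.ofReal_add (hn E) (hn Eᶜ), hsum, ENNReal.ofReal_one]
    exact hone.trans (by gcongr)
  exact (ENNReal.add_le_add_iff_right ENNReal.ofReal_ne_top).1 this

lemma measurableSet_restrictEvent (D : Finset ι) (E : Set (Set ι)) :
    MeasurableSet (restrictEvent D E) := by
  have : restrictEvent D E = (D.restrict : (ι → Bool) → (D → Bool)) ⁻¹'
      {f | {i | ∃ h : i ∈ D, f ⟨i, h⟩ = true} ∈ E} := by
    ext ω
    simp [restrictEvent]
  rw [this]
  exact Finset.measurable_restrict D (Set.toFinite _).measurableSet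

end ProductMeasure

lemma bernoulliProb_filter_of_depends {ι : Type*} {S : Finset ι} {a : ι → ℝ} {E : Set (Set ι)}
    {D : Set ι} [DecidablePred (· ∈ D)] (hD : ∀ A, A ∈ E ↔ A ∩ D ∈ E) :
    bernoulliProb S a E = bernoulliProb (S.filter (· ∈ D)) a E := by
  induction S using Finset.induction_on generalizing E with
  | empty => rfl
  | insert i S hi ih =>
    rw [bernoulliProb_insert hi, ih hD]
    by_cases hiD : i ∈ D
    · have hi' : i ∉ S.filter (· ∈ D) := fun h => hi (Finset.mem_of_mem_filter i h)
      rw [Finset.filter_insert, if_pos hiD, bernoulliProb_insert hi',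
        ih (E := {A | insert i A ∈ E}) fun A => ?_]
      simp only [Set.mem_ofPred_eq]
      rw [hD (insert i A), hD (insert i (A ∩ D)), Set.insert_inter_of_mem hiD,
        Set.insert_inter_of_mem hiD, Set.inter_assoc, Set.inter_self]
    · have : {A | insert i A ∈ E} = E := by
        ext A
        rw [Set.mem_ofPred_eq, hD (insert i A), Set.insert_inter_of_notMem hiD, ← hD]
      rw [Finset.filter_insert, if_neg hiD, this, ih hD]
      ring

section Transfer

variable {V : Type*} {G : SimpleGraph V} {p : ℝ}

/-- The event that the open cluster of `o` reaches distance `n`. -/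
def reachEvent (G : SimpleGraph V) (o : V) (n : ℕ) : Set (Set (Sym2 V)) :=
  connEvent G o {t | n ≤ G.dist o t}

/-- Finite-volume formulation of percolation: the probability that the cluster of some vertex
reaches distance `n` does not vanish as `n` grows. -/
def Percolates (G : SimpleGraph V) (p : ℝ) : Prop :=
  ∃ o, ∃ c > 0, ∀ n, ∃ S : Finset (Sym2 V),
    c ≤ bernoulliProb S (fun _ => p) (reachEvent G o n)

lemma mem_reachEvent_iff_inter (hG : G.Connected) (o : V) (n : ℕ) (A : Set (Sym2 V)) :
    A ∈ reachEvent G o n ↔ A ∩ {e | ∀ v ∈ e, G.dist o v ≤ n} ∈ reachEvent G o n := by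
  refine ⟨fun h => ?_, fun h => isUpperSet_connEvent G o _ Set.inter_subset_left h⟩
  obtain ⟨t, ht, h⟩ := h
  rcases n.eq_zero_or_pos with rfl | hn
  · exact ⟨o, Nat.zero_le _, .refl⟩
  have hstep : ∀ u v, G.Adj u v ∧ s(u, v) ∈ A → G.dist o u ≤ n → G.dist o v ≤ n →
      G.Adj u v ∧ s(u, v) ∈ A ∩ {e | ∀ v ∈ e, G.dist o v ≤ n} := by
    refine fun u v huv hu hv => ⟨huv.1, huv.2, fun w hw => ?_⟩
    rcases Sym2.mem_iff.1 hw with rfl | rfl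
    · exact hu
    · exact hv
  rcases reflTransGen_first_entry {v | n ≤ G.dist o v} h (by simpa using hn.ne') with
    ⟨-, h⟩ | ⟨i, hi, u, hu, hiu, hoi⟩
  · exact absurd ht h
  · simp only [Set.mem_ofPred_eq, not_le] at hi
    refine ⟨u, hu, (hoi.of_imp fun x y hxy => ?_).tail (hstep i u hiu hi.le ?_)⟩
    · simp only [Set.mem_ofPred_eq, not_le] at hxy
      exact hstep x y hxy.1 hxy.2.1.le hxy.2.2.le
    · have := dist_le_succ_of_adj hG o hiu.1
      omega

lemma openSubgraph_adj (ω : G.edgeSet → Bool) (u v : V) :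
    (openSubgraph G ω).Adj u v ↔ G.Adj u v ∧ s(u, v) ∈ Subtype.val '' {i | ω i = true} := by
  rw [openSubgraph, SimpleGraph.deleteEdges_adj]
  refine and_congr_right fun h => ?_
  constructor
  · intro h'
    refine ⟨⟨s(u, v), h⟩, ?_, rfl⟩
    by_contra hcon
    exact h' ⟨h, by simpa using hcon⟩
  · rintro ⟨i, hi, hiu⟩ ⟨h', h''⟩
    have : i = ⟨s(u, v), h'⟩ := Subtype.ext hiu
    rw [← this] at h''
    simp only [Set.mem_ofPred_eq] at hi
    simp [hi] at h''

lemma hasInfiniteCluster_iff (hball : ∀ o n, {t | G.dist o t ≤ n}.Finite)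
    (ω : G.edgeSet → Bool) :
    HasInfiniteCluster G ω ↔ ∃ o, ∀ n, Subtype.val '' {i | ω i = true} ∈ reachEvent G o n := by
  refine exists_congr fun o => ?_
  simp only [SimpleGraph.reachable_iff_reflTransGen]
  have hrel : ∀ w, Relation.ReflTransGen (openSubgraph G ω).Adj o w ↔
      Relation.ReflTransGen
        (fun u v => G.Adj u v ∧ s(u, v) ∈ Subtype.val '' {i | ω i = true}) o w :=
    fun w => ⟨fun h => h.of_imp fun u v => (openSubgraph_adj ω u v).1,
      fun h => h.of_imp fun u v => (openSubgraph_adj ω u v).2⟩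
  simp only [hrel]
  constructor
  · intro hinf n
    obtain ⟨t, ht, hn⟩ := hinf.exists_notMem_finite (hball o n)
    rw [Set.mem_ofPred_eq, not_le] at hn
    exact ⟨t, le_of_lt hn, ht⟩
  · intro h hfin
    obtain ⟨N, hN⟩ := (hfin.image (G.dist o)).bddAbove
    obtain ⟨t, ht, hot⟩ := h (N + 1)
    have := hN ⟨t, hot, rfl⟩
    simp only [Set.mem_ofPred_eq] at ht
    omega

variable (hG : G.Connected) (hlf : ∀ v : V, (G.neighborSet v).Finite)
  (hbd : ∃ D : ℕ, ∀ v : V, (G.neighborSet v).ncard ≤ D)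

include hG hlf hbd

lemma finite_ball (o : V) (n : ℕ) : {t | G.dist o t ≤ n}.Finite := by
  obtain ⟨f, -, hf, -⟩ := exists_ball hG hlf hbd n
  exact (f o).finite_toSet.subset fun t ht => (hf o t).2 ht

lemma countable_of_connected : Countable V := by
  obtain ⟨o⟩ := hG.nonempty
  rw [← Set.countable_univ_iff]
  refine (Set.countable_iUnion fun n => (finite_ball hG hlf hbd o n).countable).mono
    fun t _ => Set.mem_iUnion.2 ⟨G.dist o t, le_refl (G.dist o t)⟩

/-- The event that the cluster of `o` reaches distance `n` lives on finitely many coordinates. -/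
lemma exists_reachEvent_eq_restrictEvent (o : V) (n : ℕ) :
    ∃ (D : Finset G.edgeSet) (E : Set (Set G.edgeSet)),
      {ω : G.edgeSet → Bool | Subtype.val '' {i | ω i = true} ∈ reachEvent G o n} =
        restrictEvent D E ∧
      (∀ p, ∃ S : Finset (Sym2 V), bernoulliProb D (fun _ => p) E =
        bernoulliProb S (fun _ => p) (reachEvent G o n)) ∧
      ∀ p, 0 ≤ p → p ≤ 1 → ∀ S : Finset (Sym2 V),
        bernoulliProb S (fun _ => p) (reachEvent G o n) ≤ bernoulliProb D (fun _ => p) E := by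
  set K := (finite_ball hG hlf hbd o n).toFinset.sym2 with hK
  have hmemK : ∀ e, e ∈ K ↔ ∀ v ∈ e, G.dist o v ≤ n := by
    intro e
    simp [hK, Finset.mem_sym2_iff]
  set D := K.subtype (· ∈ G.edgeSet) with hD
  have himage : ∀ p, bernoulliProb D (fun _ => p) {A | Subtype.val '' A ∈ reachEvent G o n} =
      bernoulliProb (D.image Subtype.val) (fun _ => p) (reachEvent G o n) := fun p =>
    (bernoulliProb_image Subtype.val_injective D (fun _ => p) (reachEvent G o n)).symm
  refine ⟨D, {A | Subtype.val '' A ∈ reachEvent G o n}, ?_, fun p => ⟨_, himage p⟩,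
    fun p h0 h1 S => ?_⟩
  · ext ω
    rw [Set.mem_ofPred_eq, mem_reachEvent_iff_inter hG]
    simp only [restrictEvent, Set.mem_ofPred_eq]
    suffices Subtype.val '' {i : G.edgeSet | ω i = true} ∩ {e | ∀ v ∈ e, G.dist o v ≤ n} =
        Subtype.val '' {i | i ∈ D ∧ ω i = true} by rw [this]
    ext e
    constructor
    · rintro ⟨⟨i, hi, rfl⟩, he⟩
      exact ⟨i, ⟨Finset.mem_subtype.2 ((hmemK _).2 he), hi⟩, rfl⟩
    · rintro ⟨i, ⟨hiD, hi⟩, rfl⟩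
      exact ⟨⟨i, hi, rfl⟩, (hmemK _).1 (Finset.mem_subtype.1 hiD)⟩
  · rw [himage]
    have hdep : ∀ A, A ∈ reachEvent G o n ↔
        A ∩ {e | e ∈ G.edgeSet ∧ ∀ v ∈ e, G.dist o v ≤ n} ∈ reachEvent G o n := by
      intro A
      rw [mem_reachEvent_iff_inter hG]
      refine ⟨?_, fun h => isUpperSet_connEvent G o _ (fun e he => ⟨he.1, he.2.2⟩) h⟩
      rintro ⟨t, ht, h⟩
      exact ⟨t, ht, h.of_imp fun u v huv => ⟨huv.1, huv.2.1, huv.1, huv.2.2⟩⟩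
    rw [bernoulliProb_filter_of_depends hdep]
    refine bernoulliProb_le_of_subset (fun e he => ?_) (fun _ => h0) (fun _ => h1)
      (isUpperSet_connEvent G o _)
    obtain ⟨-, he1, he2⟩ := Finset.mem_filter.1 he
    exact Finset.mem_image.2 ⟨⟨e, he1⟩, Finset.mem_subtype.2 ((hmemK e).2 he2), rfl⟩

lemma percolates_of_bernoulliProduct_ne_zero (h0 : 0 ≤ p) (h1 : p ≤ 1)
    (h : bernoulliProduct G.edgeSet p {ω | HasInfiniteCluster G ω} ≠ 0) : Percolates G p := by
  contrapose! h
  have := countable_of_connected hG hlf hbd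
  have hset : {ω | HasInfiniteCluster G ω} = ⋃ o, {ω : G.edgeSet → Bool |
      ∀ n, Subtype.val '' {i | ω i = true} ∈ reachEvent G o n} := by
    ext ω
    simp [hasInfiniteCluster_iff (finite_ball hG hlf hbd)]
  rw [hset]
  refine measure_iUnion_null fun o => nonpos_iff_eq_zero.1 ?_
  refine ENNReal.le_of_forall_pos_le_add fun c hc _ => ?_
  unfold Percolates at h
  push Not at h
  obtain ⟨n, hn⟩ := h o c hc
  obtain ⟨D, E, heq, hS, -⟩ := exists_reachEvent_eq_restrictEvent hG hlf hbd o n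
  obtain ⟨S, hS⟩ := hS p
  calc bernoulliProduct G.edgeSet p
        {ω | ∀ n, Subtype.val '' {i | ω i = true} ∈ reachEvent G o n}
      ≤ bernoulliProduct G.edgeSet p (restrictEvent D E) := by
        rw [← heq]
        exact measure_mono fun ω hω => hω n
    _ ≤ ENNReal.ofReal (bernoulliProb D (fun _ => p) E) :=
        bernoulliProduct_restrictEvent_le h0 h1 D E
    _ ≤ ENNReal.ofReal c := ENNReal.ofReal_le_ofReal (by rw [hS]; exact (hn S).le)
    _ = 0 + c := by simp

lemma bernoulliProduct_ne_zero_of_percolates (h0 : 0 ≤ p) (h1 : p ≤ 1) (h : Percolates G p) :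
    bernoulliProduct G.edgeSet p {ω | HasInfiniteCluster G ω} ≠ 0 := by
  obtain ⟨o, c, hc, h⟩ := h
  have := isProbabilityMeasure_bernoulliMeasure h0 h1
  set P := Measure.infinitePi fun _ : G.edgeSet => bernoulliMeasure p
  set E : ℕ → Set (G.edgeSet → Bool) :=
    fun n => {ω | Subtype.val '' {i | ω i = true} ∈ reachEvent G o n} with hE
  have hmeas : ∀ n, MeasurableSet (E n) := by
    intro n
    obtain ⟨D, F, heq, -⟩ := exists_reachEvent_eq_restrictEvent hG hlf hbd o n
    simp only [hE, heq]
    exact measurableSet_restrictEvent D F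
  have hanti : Antitone E := by
    rintro m n hmn ω ⟨t, ht, h⟩
    exact ⟨t, le_trans hmn ht, h⟩
  have hlow : ∀ n, ENNReal.ofReal c ≤ P (E n) := by
    intro n
    obtain ⟨D, F, heq, -, hS⟩ := exists_reachEvent_eq_restrictEvent hG hlf hbd o n
    obtain ⟨S, hcS⟩ := h n
    simp only [hE, heq]
    exact (ENNReal.ofReal_le_ofReal (hcS.trans (hS p h0 h1 S))).trans
      (ofReal_bernoulliProb_le_infinitePi h0 h1 D F)
  have hinf : ENNReal.ofReal c ≤ P (⋂ n, E n) := by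
    rw [hanti.measure_iInter (fun n => (hmeas n).nullMeasurableSet) ⟨0, measure_ne_top _ _⟩]
    exact le_iInf hlow
  have hpos : 0 < bernoulliProduct G.edgeSet p {ω | HasInfiniteCluster G ω} := by
    refine (ENNReal.ofReal_pos.2 hc).trans_le (hinf.trans ?_)
    refine (infinitePi_le_bernoulliProduct _).trans (measure_mono fun ω hω => ?_)
    exact (hasInfiniteCluster_iff (finite_ball hG hlf hbd) ω).2 ⟨o, fun n => Set.mem_iInter.1 hω n⟩
  exact hpos.ne'

end Transfer

section Threshold

variable {V : Type*} {G : SimpleGraph V} {p : ℝ}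

lemma exists_first_edge_of_mem_connEvent {v : V} {T : Set V} (hv : v ∉ T) {A : Set (Sym2 V)}
    (hA : A ∈ connEvent G v T) :
    ∃ w, G.Adj v w ∧ s(v, w) ∈ A ∧ A \ {s(v, w)} ∈ connEvent G w T := by
  obtain ⟨t, ht, h⟩ := hA
  have htv : t ∉ ({v} : Set V) := fun h' => hv (h' ▸ ht)
  have key : ∀ w c, Relation.ReflTransGen (fun x y => (G.Adj x y ∧ s(x, y) ∈ A) ∧
      x ∉ ({v} : Set V) ∧ y ∉ ({v} : Set V)) c t →
      Relation.ReflTransGen (fun x y => G.Adj x y ∧ s(x, y) ∈ A \ {s(v, w)}) c t := by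
    refine fun w c h => h.of_imp fun x y hxy => ⟨hxy.1.1, hxy.1.2, fun heq => ?_⟩
    rcases Sym2.eq_iff.1 heq with ⟨h', -⟩ | ⟨-, h'⟩
    · exact hxy.2.1 h'
    · exact hxy.2.2 h'
  rcases reflTransGen_last_exit {v} h htv with h | ⟨b, rfl, c, -, hbc, h⟩
  · rcases Relation.ReflTransGen.cases_head h with rfl | ⟨c, hc, -⟩
    · exact absurd rfl htv
    · exact absurd rfl hc.2.1
  · exact ⟨c, hbc.1, hbc.2, t, ht, key c c h⟩

lemma bernoulliProb_mem_and_sdiff_le {ι : Type*} (h0 : 0 ≤ p) (S : Finset ι)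
    (i : ι) (F : Set (Set ι)) {x : ℝ} (hx : 0 ≤ x)
    (hF : ∀ S : Finset ι, bernoulliProb S (fun _ => p) F ≤ x) :
    bernoulliProb S (fun _ => p) {A | i ∈ A ∧ A \ {i} ∈ F} ≤ p * x := by
  have hzero : ∀ S : Finset ι, i ∉ S →
      bernoulliProb S (fun _ => p) {A | i ∈ A ∧ A \ {i} ∈ F} = 0 := by
    refine fun S hi => Finset.sum_eq_zero fun A hA => ?_
    rw [if_neg, mul_zero]
    exact fun h => hi (Finset.mem_powerset.1 hA (by exact_mod_cast h.1))
  by_cases hi : i ∈ S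
  · obtain ⟨S, hiS, rfl⟩ : ∃ S', i ∉ S' ∧ insert i S' = S :=
      ⟨S.erase i, Finset.notMem_erase i S, Finset.insert_erase hi⟩
    rw [bernoulliProb_insert hiS, hzero S hiS, mul_zero, add_zero]
    refine mul_le_mul_of_nonneg_left (le_of_eq_of_le ?_ (hF S)) h0
    refine bernoulliProb_congr_event fun A hA => ?_
    have : i ∉ A := fun h => hiS (by exact_mod_cast hA h)
    simp [this]
  · rw [hzero S hi]
    exact mul_nonneg h0 hx

/-- Path counting. -/
lemma bernoulliProb_connEvent_le (hG : G.Connected) (hlf : ∀ v : V, (G.neighborSet v).Finite)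
    {D : ℕ} (hD : ∀ v : V, (G.neighborSet v).ncard ≤ D) (h0 : 0 ≤ p) (h1 : p ≤ 1) (n : ℕ) {v : V}
    {T : Set V} (hT : ∀ t ∈ T, n ≤ G.dist v t) (S : Finset (Sym2 V)) :
    bernoulliProb S (fun _ => p) (connEvent G v T) ≤ (D * p) ^ n := by
  induction n generalizing v S with
  | zero =>
    rw [pow_zero]
    exact bernoulliProb_le_one (fun _ _ => h0) (fun _ _ => h1) _
  | succ n ih =>
    have hv : v ∉ T := fun h => by simpa using hT v h
    have hpow : 0 ≤ (D * p) ^ n := by positivity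
    calc bernoulliProb S (fun _ => p) (connEvent G v T)
        ≤ bernoulliProb S (fun _ => p) (⋃ w ∈ (hlf v).toFinset,
            {A | s(v, w) ∈ A ∧ A \ {s(v, w)} ∈ connEvent G w T}) := by
          refine bernoulliProb_mono (fun _ _ => h0) (fun _ _ => h1) fun A _ _ _ hA => ?_
          obtain ⟨w, hvw, hA⟩ := exists_first_edge_of_mem_connEvent hv hA
          simp only [Set.mem_iUnion]
          exact ⟨w, by simpa using hvw, hA⟩
      _ ≤ ∑ w ∈ (hlf v).toFinset, bernoulliProb S (fun _ => p)
            {A | s(v, w) ∈ A ∧ A \ {s(v, w)} ∈ connEvent G w T} :=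
          bernoulliProb_biUnion_le (fun _ _ => h0) (fun _ _ => h1) _ _
      _ ≤ ∑ w ∈ (hlf v).toFinset, p * (D * p) ^ n := by
          refine Finset.sum_le_sum fun w hw => ?_
          refine bernoulliProb_mem_and_sdiff_le h0 S _ _ hpow fun S => ih (fun t ht => ?_) S
          have hvw : G.Adj w v := by simpa [G.adj_comm] using hw
          have := dist_le_succ_of_adj hG t hvw
          have h2 := hT t ht
          rw [SimpleGraph.dist_comm] at h2
          rw [SimpleGraph.dist_comm]
          omega
      _ = ((hlf v).toFinset.card : ℝ) * (p * (D * p) ^ n) := by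
          rw [Finset.sum_const, nsmul_eq_mul]
      _ ≤ D * (p * (D * p) ^ n) := by
          have : (hlf v).toFinset.card ≤ D := by
            rw [← Set.ncard_eq_toFinset_card _ (hlf v)]
            exact hD v
          gcongr
      _ = (D * p) ^ (n + 1) := by ring

lemma Percolates.mono {q : ℝ} (hp0 : 0 ≤ p) (hpq : p ≤ q) (hq : q ≤ 1) (h : Percolates G p) :
    Percolates G q := by
  obtain ⟨o, c, hc, h⟩ := h
  refine ⟨o, c, hc, fun n => ?_⟩
  obtain ⟨S, hS⟩ := h n
  exact ⟨S, hS.trans (bernoulliProb_le_of_le (fun _ _ => hp0) (fun _ _ => hq) (fun _ _ => hpq)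
    (isUpperSet_connEvent G o _))⟩

variable (hG : G.Connected) (hlf : ∀ v : V, (G.neighborSet v).Finite)
  (hbd : ∃ D : ℕ, ∀ v : V, (G.neighborSet v).ncard ≤ D)

lemma le_pc {p : ℝ} (h0 : 0 ≤ p) (h1 : p ≤ 1)
    (h : bernoulliProduct G.edgeSet p {ω | HasInfiniteCluster G ω} = 0) : p ≤ pc G :=
  le_csSup ⟨1, fun _ hq => hq.1.2⟩ ⟨⟨h0, h1⟩, h⟩

include hG hlf hbd

lemma pc_pos : 0 < pc G := by
  obtain ⟨D, hD⟩ := hbd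
  set p : ℝ := 1 / (2 * (D + 1)) with hp
  have hp0 : 0 < p := by positivity
  have hD0 : (0 : ℝ) ≤ D := D.cast_nonneg
  have hDp : D * p ≤ 1 / 2 := by
    rw [hp, mul_one_div, div_le_div_iff₀ (by positivity) (by norm_num)]
    linarith
  have hp1 : p ≤ 1 := by
    rw [hp, div_le_one (by positivity)]
    linarith
  refine hp0.trans_le (le_pc hp0.le hp1 ?_)
  by_contra hne
  obtain ⟨o, c, hc, h⟩ := percolates_of_bernoulliProduct_ne_zero hG hlf ⟨D, hD⟩ hp0.le hp1 hne
  obtain ⟨n, hn⟩ := exists_pow_lt_of_lt_one hc (show (1 / 2 : ℝ) < 1 by norm_num)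
  obtain ⟨S, hS⟩ := h n
  have hle := bernoulliProb_connEvent_le hG hlf hD hp0.le hp1 n
    (v := o) (T := {t | n ≤ G.dist o t}) (fun _ ht => ht) S
  have : (D * p) ^ n ≤ (1 / 2 : ℝ) ^ n := by gcongr
  exact absurd (hS.trans (hle.trans this)) (not_le.2 hn)

lemma percolates_of_pc_lt (hp : pc G < p) (h1 : p ≤ 1) : Percolates G p := by
  have h0 := (pc_pos hG hlf hbd).le.trans hp.le
  refine percolates_of_bernoulliProduct_ne_zero hG hlf hbd h0 h1 fun h => ?_
  exact absurd (le_pc h0 h1 h) (not_le.2 hp)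

lemma pc_le_of_percolates (h0 : 0 ≤ p) (h : Percolates G p) : pc G ≤ p := by
  refine Real.sSup_le (fun q hq => ?_) h0
  by_contra hlt
  rw [not_le] at hlt
  exact bernoulliProduct_ne_zero_of_percolates hG hlf hbd hq.1.1 hq.1.2
    (h.mono h0 hlt.le hq.1.2) hq.2

end Threshold

lemma IsStrongCoveringMap.surjective {VG VH : Type*} {G : SimpleGraph VG} {H : SimpleGraph VH}
    {π : VG → VH} (hcov : IsStrongCoveringMap G H π) (hG : G.Connected) (hH : H.Connected) :
    Function.Surjective π := by
  obtain ⟨x⟩ := hG.nonempty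
  intro u
  have h := hH.preconnected (π x) u
  rw [SimpleGraph.reachable_iff_reflTransGen] at h
  induction h with
  | refl => exact ⟨x, rfl⟩
  | tail _ huv ih =>
    obtain ⟨y, rfl⟩ := ih
    obtain ⟨z, hz, -⟩ := hcov.2 y _ huv
    exact ⟨z, hz.2⟩

/-- Martineau–Severo. Let `G`, `H` be locally finite, connected,
infinite simple graphs of bounded degree and `π : V(G) → V(H)` a strong covering map
with uniformly non-trivial fibres. If `p_c(G) < 1` then `p_c(G) < p_c(H)`. -/
theorem pc_strict_lt_of_strongCoveringMap {VG VH : Type*}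
    (G : SimpleGraph VG) (H : SimpleGraph VH)
    (hGconn : G.Connected) (hGinf : Infinite VG)
    (hGlf : ∀ v : VG, (G.neighborSet v).Finite)
    (hGbd : ∃ D : ℕ, ∀ v : VG, (G.neighborSet v).ncard ≤ D)
    (hHconn : H.Connected) (hHinf : Infinite VH)
    (hHlf : ∀ v : VH, (H.neighborSet v).Finite)
    (hHbd : ∃ D : ℕ, ∀ v : VH, (H.neighborSet v).ncard ≤ D)
    (π : VG → VH) (hcov : IsStrongCoveringMap G H π)
    (hfib : HasUniformlyNontrivialFibres G π)
    (hpc : pc G < 1) :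
    pc G < pc H := by
  by_contra hle
  rw [not_lt] at hle
  have hpos : 0 < pc G := (pc_pos hHconn hHlf hHbd).trans_le hle
  obtain ⟨L, s, hs0, hs1, hdom⟩ := exists_enhancement_domination hGconn hGlf hGbd hHconn hHlf hHbd
    hcov hfib (half_pos hpos) (by linarith)
  obtain ⟨δ, hδ0, hδ, hinterp⟩ := exists_interpolation hHconn hHlf hHbd L hpos
    (show pc G ≤ (1 + pc G) / 2 by linarith) (by linarith) hs0 hs1
  set q := min ((1 + pc G) / 2) (pc G + δ / 2)
  have hq : pc G < q := lt_min (by linarith) (by linarith)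
  have hq1 : q ≤ (1 + pc G) / 2 := min_le_left _ _
  have hq2 : q ≤ pc G + δ / 2 := min_le_right _ _
  obtain ⟨o, c, hc, hperc⟩ := percolates_of_pc_lt hHconn hHlf hHbd (hle.trans_lt hq) (by linarith)
  obtain ⟨o, rfl⟩ := hcov.surjective hGconn hHconn o
  have hGperc : Percolates G (q - δ) := by
    refine ⟨o, c, hc, fun m => ?_⟩
    obtain ⟨S, hS⟩ := hperc (m + (2 * L + 1))
    obtain ⟨S₁, hS₁⟩ := hinterp q hq.le hq1 (π o) m S
    obtain ⟨S₂, hS₂⟩ := hdom (q - δ) (by linarith) (by linarith) o m S₁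
    refine ⟨S₂, hS.trans (hS₁.trans (hS₂.trans ?_))⟩
    refine bernoulliProb_mono (fun _ _ => by linarith) (fun _ _ => by linarith) fun A _ _ _ hA => ?_
    obtain ⟨t, ht, h⟩ := hA
    exact ⟨t, le_trans ht (hcov.1 o t), h⟩
  have := pc_le_of_percolates hGconn hGlf hGbd (by linarith) hGperc
  linarith
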